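/- For every finite group G, the non-supersoluble graph of G is connected: for any x, y ∈ G such that ⟨x,u⟩ is not supersoluble for some u ∈ G and ⟨y,v⟩ is not supersoluble for some v ∈ G, there exist elements z₀ = x, z₁, …, z_n = y of G such that ⟨z_i, z_{i+1}⟩ is not supersoluble for every 0 ≤ i < n. -/

import Mathlib

universe u

/-- The factor group `B / A` is cyclic, for subgroups `A ≤ B` of an ambient group
with `A` normal in the ambient group. -/
def CyclicFactor {X : Type u} [Group X] (A B : Subgroup X) (hA : A.Normal) : Prop :=
  letI : (A.subgroupOf B).Normal := hA.subgroupOf B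
  IsCyclic (↥B ⧸ A.subgroupOf B)

/-- `X` is supersoluble: there is a chain `1 = H₀ ≤ H₁ ≤ … ≤ H_k = X` of subgroups,
each normal in `X`, with all factors `H_i / H_{i-1}` cyclic. -/
def IsSupersoluble (X : Type u) [Group X] : Prop :=
  ∃ (k : ℕ) (H : Fin (k + 1) → Subgroup X) (hnorm : ∀ i, (H i).Normal),
    H 0 = ⊥ ∧ H (Fin.last k) = ⊤ ∧ (∀ i : Fin k, H i.castSucc ≤ H i.succ) ∧
    ∀ i : Fin k, CyclicFactor (H i.castSucc) (H i.succ) (hnorm i.castSucc)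


/-! ### Basic p-element API -/
namespace NSG
open Subgroup

def PEl (p : ℕ) {G : Type u} [Group G] (g : G) : Prop := ∃ k : ℕ, g ^ (p ^ k) = 1

section base
variable {p : ℕ} {G : Type u} [Group G] {K : Type u} [Group K]

lemma PEl.of_mem {S : Subgroup G} (hS : IsPGroup p S) {g : G} (hg : g ∈ S) : PEl p g := by
  obtain ⟨k, hk⟩ := hS ⟨g, hg⟩
  exact ⟨k, by simpa using congrArg Subtype.val hk⟩

lemma PEl.one : PEl p (1 : G) := ⟨0, by simp⟩

lemma PEl.map {g : G} (h : PEl p g) (f : G →* K) : PEl p (f g) := by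
  obtain ⟨k, hk⟩ := h
  exact ⟨k, by rw [← map_pow, hk, map_one]⟩

lemma PEl.of_map {g : G} (f : G →* K) (hf : Function.Injective f) (h : PEl p (f g)) : PEl p g := by
  obtain ⟨k, hk⟩ := h
  exact ⟨k, hf (by rw [map_pow, hk, map_one])⟩

lemma PEl.conj {g : G} (h : PEl p g) (x : G) : PEl p (x * g * x⁻¹) := by
  have := h.map (MulAut.conj x).toMonoidHom
  simpa using this

lemma PEl.pow {g : G} (h : PEl p g) (n : ℕ) : PEl p (g ^ n) := by
  obtain ⟨k, hk⟩ := h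
  exact ⟨k, by rw [← pow_mul, mul_comm, pow_mul, hk, one_pow]⟩

lemma PEl.inv {g : G} (h : PEl p g) : PEl p (g⁻¹) := by
  obtain ⟨k, hk⟩ := h
  exact ⟨k, by rw [inv_pow, hk, inv_one]⟩

lemma PEl.mul_comm {g h : G} (hg : PEl p g) (hh : PEl p h) (hc : Commute g h) : PEl p (g * h) := by
  obtain ⟨k, hk⟩ := hg
  obtain ⟨l, hl⟩ := hh
  refine ⟨k + l, ?_⟩
  rw [hc.mul_pow, pow_add, pow_mul, hk, one_pow, _root_.mul_comm (p ^ k), pow_mul, hl, one_pow, one_mul]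

lemma PEl.zpowers {g : G} (h : PEl p g) : IsPGroup p (zpowers g) := by
  rintro ⟨x, hx⟩
  obtain ⟨n, rfl⟩ := mem_zpowers_iff.1 hx
  obtain ⟨k, hk⟩ := h
  refine ⟨k, Subtype.ext ?_⟩
  simp only [SubmonoidClass.mk_pow, OneMemClass.coe_one]
  rw [← zpow_natCast, ← zpow_mul, _root_.mul_comm, zpow_mul, zpow_natCast, hk, one_zpow]

lemma PEl.exists_sylow {g : G} (h : PEl p g) : ∃ P : Sylow p G, g ∈ P := by
  obtain ⟨P, hP⟩ := h.zpowers.exists_le_sylow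
  exact ⟨P, hP (mem_zpowers g)⟩

/-- the largest normal `p`-subgroup -/
def Op (p : ℕ) (G : Type u) [Group G] : Subgroup G := ⨅ P : Sylow p G, (P : Subgroup G)

lemma Op_normal : (Op p G).Normal := by
  constructor
  intro n hn g
  simp only [Op, mem_iInf] at hn ⊢
  intro P
  have := hn (g⁻¹ • P)
  have h2 : n ∈ ((g⁻¹ • P : Sylow p G) : Subgroup G) := this
  rw [Sylow.coe_subgroup_smul, Subgroup.mem_pointwise_smul_iff_inv_smul_mem] at h2
  simpa using h2

lemma Op_pgroup : IsPGroup p (Op p G) := by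
  obtain ⟨P⟩ : Nonempty (Sylow p G) := inferInstance
  exact P.isPGroup'.to_le (iInf_le _ P)

lemma le_Op {W : Subgroup G} (hW : IsPGroup p W) (hn : W.Normal) : W ≤ Op p G := by
  refine le_iInf fun P => ?_
  exact hW.le_sylow_of_normal P

/-- largest normal `p`-subgroup of a subgroup, inside the ambient group -/
def OpIn (p : ℕ) (H : Subgroup G) : Subgroup G := (Op p ↥H).map H.subtype

variable {H : Subgroup G}

lemma OpIn_le : OpIn p H ≤ H := by
  rintro x ⟨y, -, rfl⟩; exact y.2

lemma OpIn_pgroup : IsPGroup p (OpIn p H) := Op_pgroup.map _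

lemma OpIn_nz {h v : G} (hh : h ∈ H) (hv : v ∈ OpIn p H) : h * v * h⁻¹ ∈ OpIn p H := by
  obtain ⟨y, hy, rfl⟩ := hv
  exact ⟨⟨h, hh⟩ * y * ⟨h, hh⟩⁻¹, Op_normal.conj_mem y hy _, rfl⟩

lemma OpIn_nz_iff {h v : G} (hh : h ∈ H) : h * v * h⁻¹ ∈ OpIn p H ↔ v ∈ OpIn p H := by
  refine ⟨fun h1 => ?_, OpIn_nz hh⟩
  have := OpIn_nz (inv_mem hh) h1
  simpa [mul_assoc] using this

lemma le_OpIn {W : Subgroup G} (hWH : W ≤ H) (hW : IsPGroup p W)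
    (hn : ∀ h ∈ H, ∀ w ∈ W, h * w * h⁻¹ ∈ W) : W ≤ OpIn p H := by
  have h1 : (W.subgroupOf H).Normal := by
    constructor
    intro n hn' g
    rw [mem_subgroupOf] at hn' ⊢
    exact hn _ g.2 _ hn'
  have h2 : IsPGroup p (W.subgroupOf H) :=
    hW.comap_of_injective H.subtype (subtype_injective H)
  have h3 := le_Op h2 h1
  intro w hw
  exact ⟨⟨w, hWH hw⟩, h3 (by simpa [mem_subgroupOf] using hw), rfl⟩

lemma OpIn_conj_nz {g : G} (hH : H.Normal) {v : G} (hv : v ∈ OpIn p H) :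
    g * v * g⁻¹ ∈ OpIn p H := by
  have : (OpIn p H).map (MulAut.conj g).toMonoidHom ≤ OpIn p H := by
    refine le_OpIn ?_ (OpIn_pgroup.map _) ?_
    · rintro _ ⟨y, hy, rfl⟩
      exact hH.conj_mem _ (OpIn_le hy) g
    · rintro h hh _ ⟨y, hy, rfl⟩
      refine ⟨(g⁻¹ * h * g) * y * (g⁻¹ * h * g)⁻¹, OpIn_nz ?_ hy, ?_⟩
      · simpa using hH.conj_mem _ hh g⁻¹
      · simp [mul_assoc]
  exact this ⟨v, hv, rfl⟩

lemma sup_pgroup {S W : Subgroup G} (hS : IsPGroup p S) (hW : IsPGroup p W)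
    (hn : ∀ s ∈ S, ∀ w ∈ W, s * w * s⁻¹ ∈ W) : IsPGroup p ↥(S ⊔ W) := by
  refine hS.to_sup_of_normal_right' hW ?_
  intro s hs
  rw [mem_normalizer_iff]
  intro n
  refine ⟨fun h => hn s hs n h, fun h => ?_⟩
  have := hn s⁻¹ (inv_mem hs) _ h
  simpa [mul_assoc] using this

/-- a maximal `p`-subgroup of `H` contains `OpIn`. -/
lemma OpIn_le_of_max {S : Subgroup G} (hS : IsPGroup p S) (hSH : S ≤ H)
    (hmax : ∀ T : Subgroup G, IsPGroup p T → T ≤ H → S ≤ T → T ≤ S) : OpIn p H ≤ S := by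
  have := hmax (S ⊔ OpIn p H) (sup_pgroup hS OpIn_pgroup fun s hs w hw => OpIn_nz (hSH hs) hw)
    (sup_le hSH OpIn_le) le_sup_left
  exact le_sup_right.trans this

lemma sylow_max (P : Sylow p G) {T : Subgroup G} (hT : IsPGroup p T) (h : (P : Subgroup G) ≤ T) :
    T ≤ P := (P.is_maximal' hT h).le

lemma OpIn_le_sylow (P : Sylow p G) (h : (P : Subgroup G) ≤ H) : OpIn p H ≤ P :=
  OpIn_le_of_max P.isPGroup' h fun _ hT _ h => sylow_max P hT h

/-- two proper subgroups do not cover -/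
lemma exists_not_mem_two {S V W : Subgroup G} (hV : ¬ S ≤ V) (hW : ¬ S ≤ W) :
    ∃ c ∈ S, c ∉ V ∧ c ∉ W := by
  obtain ⟨a, ha, haV⟩ := SetLike.not_le_iff_exists.1 hV
  obtain ⟨b, hb, hbW⟩ := SetLike.not_le_iff_exists.1 hW
  by_cases h1 : a ∈ W
  · by_cases h2 : b ∈ V
    · refine ⟨a * b, mul_mem ha hb, fun h => haV ?_, fun h => hbW ?_⟩
      · exact (mul_mem_cancel_right h2).1 h
      · exact (mul_mem_cancel_left h1).1 h
    · exact ⟨b, hb, h2, hbW⟩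
  · exact ⟨a, ha, haV, h1⟩

lemma exists_max_pgroup [Finite G] {S : Subgroup G} (hS : IsPGroup p S) (hSH : S ≤ H) :
    ∃ T : Subgroup G, IsPGroup p T ∧ T ≤ H ∧ S ≤ T ∧
      ∀ T' : Subgroup G, IsPGroup p T' → T' ≤ H → T ≤ T' → T' ≤ T := by
  have hfin : {T : Subgroup G | IsPGroup p T ∧ T ≤ H ∧ S ≤ T}.Finite := Set.toFinite _
  obtain ⟨T, hT⟩ := hfin.exists_maximal ⟨S, hS, hSH, le_rfl⟩
  refine ⟨T, hT.1.1, hT.1.2.1, hT.1.2.2, fun T' h1 h2 h3 => ?_⟩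
  exact hT.2 ⟨h1, h2, hT.1.2.2.trans h3⟩ h3

lemma exists_normalizing [Finite G] [Fact p.Prime] {T Q : Subgroup G} (hQ : IsPGroup p Q)
    (hTQ : T ≤ Q) (hne : ¬ Q ≤ T) :
    ∃ x ∈ Q, x ∉ T ∧ ∀ t, t ∈ T ↔ x * t * x⁻¹ ∈ T := by
  have hnil : Group.IsNilpotent Q := hQ.isNilpotent
  have hc : NormalizerCondition Q := Group.normalizerCondition_of_isNilpotent
  have h1 : T.subgroupOf Q < ⊤ := by
    rw [lt_top_iff_ne_top, Ne, subgroupOf_eq_top]; exact hne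
  obtain ⟨x, hx, hxT⟩ := SetLike.exists_of_lt (hc _ h1)
  refine ⟨x, x.2, fun h => hxT (by simpa [mem_subgroupOf] using h), fun t => ?_⟩
  rw [mem_normalizer_iff] at hx
  constructor
  · intro ht
    have := (hx ⟨t, hTQ ht⟩).1 (by simpa [mem_subgroupOf] using ht)
    simpa [mem_subgroupOf] using this
  · intro ht
    have htQ : t ∈ Q := by
      have := Q.mul_mem (Q.mul_mem (Q.inv_mem x.2) (hTQ ht)) x.2
      simpa [mul_assoc] using this
    have := (hx ⟨t, htQ⟩).2 (by simpa [mem_subgroupOf] using ht)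
    simpa [mem_subgroupOf] using this

lemma exists_center [Finite G] [Fact p.Prime] {Q : Subgroup G} (hQ : IsPGroup p Q) (hne : Q ≠ ⊥) :
    ∃ z ∈ Q, z ≠ 1 ∧ ∀ q ∈ Q, q * z = z * q := by
  have : Nontrivial Q := (nontrivial_iff_ne_bot Q).2 hne
  have := hQ.bot_lt_center
  obtain ⟨z, hz, hz1⟩ := SetLike.exists_of_lt this
  refine ⟨z, z.2, fun h => hz1 (by simpa using h), fun q hq => ?_⟩
  have := mem_center_iff.1 hz ⟨q, hq⟩
  simpa using congrArg Subtype.val this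

lemma sylow_conj_in [Finite G] [Fact p.Prime] {M : Subgroup G} (P Q : Sylow p G)
    (hP : (P : Subgroup G) ≤ M) (hQ : (Q : Subgroup G) ≤ M) :
    ∃ m ∈ M, ∀ g, g ∈ P ↔ m * g * m⁻¹ ∈ Q := by
  obtain ⟨m, hm⟩ := MulAction.exists_smul_eq M (P.subtype hP) (Q.subtype hQ)
  have h1 : ∀ g ∈ P, (m : G) * g * (m : G)⁻¹ ∈ Q := by
    intro g hg
    have h2 : (m • (⟨g, hP hg⟩ : M)) = (m * ⟨g, hP hg⟩ * m⁻¹) ∨ True := Or.inr trivial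
    have h3 : m * ⟨g, hP hg⟩ * m⁻¹ ∈ (m • P.subtype hP) := by
      have : m * ⟨g, hP hg⟩ * m⁻¹ ∈ ((m • P.subtype hP : Sylow p M) : Subgroup M) := by
        rw [Sylow.coe_subgroup_smul, Subgroup.mem_pointwise_smul_iff_inv_smul_mem]
        have hg' : g ∈ (P : Subgroup G) := hg
        simpa [mul_assoc, mem_subgroupOf] using hg'
      exact this
    rw [hm] at h3
    have h4 : m * ⟨g, hP hg⟩ * m⁻¹ ∈ ((Q.subtype hQ : Sylow p M) : Subgroup M) := h3
    rw [Sylow.coe_subtype, mem_subgroupOf] at h4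
    exact h4
  have h5 : (P : Subgroup G).map (MulAut.conj (m : G)).toMonoidHom = Q := by
    apply Subgroup.eq_of_le_of_card_ge
    · rintro _ ⟨g, hg, rfl⟩
      exact h1 g hg
    · rw [Subgroup.card_map_of_injective (MulAut.conj (m : G)).injective]
      exact (Nat.card_congr (Sylow.equiv P Q).toEquiv).ge
  refine ⟨m, m.2, fun g => ⟨h1 g, fun h => ?_⟩⟩
  have h6 : (m : G) * g * (m : G)⁻¹ ∈ (Q : Subgroup G) := h
  rw [← h5] at h6
  obtain ⟨y, hy, hye⟩ := h6
  have : y = g := by simpa using hye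
  exact this ▸ hy

lemma sylow_conj [Finite G] [Fact p.Prime] (P Q : Sylow p G) :
    ∃ m : G, ∀ g, g ∈ P ↔ m * g * m⁻¹ ∈ Q := by
  obtain ⟨m, -, h⟩ := sylow_conj_in (M := ⊤) P Q le_top le_top
  exact ⟨m, h⟩

/-- in a subgroup containing a Sylow subgroup, each p-subgroup is contained in a Sylow of `G` -/
lemma sylow_of_subgroup [Finite G] [Fact p.Prime] {M S : Subgroup G} (P : Sylow p G)
    (hP : (P : Subgroup G) ≤ M) (hS : IsPGroup p S) (hSM : S ≤ M) :
    ∃ Q : Sylow p G, S ≤ Q ∧ (Q : Subgroup G) ≤ M := by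
  have h1 : IsPGroup p (S.subgroupOf M) := hS.comap_of_injective M.subtype (subtype_injective M)
  obtain ⟨R, hR⟩ := h1.exists_le_sylow
  have h2 : Nat.card ((R : Subgroup M).map M.subtype) = Nat.card P := by
    rw [Subgroup.card_map_of_injective (subtype_injective M), Nat.card_congr (Sylow.equiv R (P.subtype hP)).toEquiv,
      Sylow.coe_subtype]
    exact Nat.card_congr (subgroupOfEquivOfLe hP).toEquiv
  have h3 : IsPGroup p ((R : Subgroup M).map M.subtype) := R.isPGroup'.map _
  obtain ⟨Q, hQ⟩ := h3.exists_le_sylow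
  have h4 : (R : Subgroup M).map M.subtype = Q := by
    apply Subgroup.eq_of_le_of_card_ge hQ
    rw [h2]; exact (Nat.card_congr (Sylow.equiv P Q).toEquiv).ge
  refine ⟨Q, ?_, ?_⟩
  · rw [← h4]
    intro s hs
    exact ⟨⟨s, hSM hs⟩, hR (by simpa [mem_subgroupOf] using hs), rfl⟩
  · rw [← h4]
    rintro _ ⟨y, -, rfl⟩; exact y.2

end base
end NSG

namespace NSG
open Subgroup

section ThmP
variable {p : ℕ} {G : Type u} [Group G] {K : Type u} [Group K]

def padj (p : ℕ) {G : Type u} [Group G] (x y : G) : Prop :=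
  PEl p x ∧ PEl p y ∧ ¬ IsPGroup p (closure {x, y})

def Conn (p : ℕ) {G : Type u} [Group G] (a b : G) : Prop :=
  ∀ A : Set G, (∀ x y, padj p x y → (x ∈ A ↔ y ∈ A)) → (a ∈ A ↔ b ∈ A)

lemma Conn.refl (a : G) : Conn p a a := fun _ _ => Iff.rfl
lemma Conn.symm {a b : G} (h : Conn p a b) : Conn p b a := fun A hA => (h A hA).symm
lemma Conn.trans {a b c : G} (h : Conn p a b) (h' : Conn p b c) : Conn p a c :=
  fun A hA => (h A hA).trans (h' A hA)
lemma padj.conn {a b : G} (h : padj p a b) : Conn p a b := fun _ hA => hA _ _ h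

lemma padj.map (f : G →* K) (hf : Function.Injective f) {a b : G} (h : padj p a b) :
    padj p (f a) (f b) := by
  refine ⟨h.1.map f, h.2.1.map f, fun hh => h.2.2 ?_⟩
  have h1 : closure {f a, f b} = (closure {a, b}).map f := by
    rw [MonoidHom.map_closure, Set.image_pair]
  rw [h1] at hh
  exact hh.of_equiv ((closure {a, b}).equivMapOfInjective f hf).symm

lemma Conn.map (f : G →* K) (hf : Function.Injective f) {a b : G} (h : Conn p a b) :
    Conn p (f a) (f b) := fun A hA => h (f ⁻¹' A) fun _ _ hxy => hA _ _ (hxy.map f hf)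

lemma Conn.conj {a b : G} (h : Conn p a b) (g : G) : Conn p (g * a * g⁻¹) (g * b * g⁻¹) := by
  simpa using h.map (MulAut.conj g).toMonoidHom (MulAut.conj g).injective

lemma Conn.conj_iff {a b : G} (g : G) : Conn p (g * a * g⁻¹) (g * b * g⁻¹) ↔ Conn p a b := by
  refine ⟨fun h => ?_, fun h => h.conj g⟩
  simpa [mul_assoc] using h.conj g⁻¹

lemma padj_or {a b : G} (ha : PEl p a) (hb : PEl p b) :
    padj p a b ∨ ∃ P : Sylow p G, a ∈ P ∧ b ∈ P := by
  by_cases h : IsPGroup p (closure {a, b})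
  · obtain ⟨P, hP⟩ := h.exists_le_sylow
    exact Or.inr ⟨P, hP (subset_closure (by simp)), hP (subset_closure (by simp))⟩
  · exact Or.inl ⟨ha, hb, h⟩

/-- the induction hypothesis for proper subgroups -/
def IHsub (p : ℕ) (G : Type u) [Group G] : Prop :=
  ∀ H : Subgroup G, H ≠ ⊤ → ∀ a b, a ∈ H → b ∈ H → PEl p a → PEl p b →
    a ∉ OpIn p H → b ∉ OpIn p H → Conn p a b

lemma pgroup_normal_bot (hO : Op p G = ⊥) {Y : Subgroup G} (hY : IsPGroup p Y)
    (h : normalizer (Y : Set G) = ⊤) : Y = ⊥ := by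
  have : Y ≤ Op p G := le_Op hY (normalizer_eq_top_iff.1 h)
  rw [hO] at this
  exact le_bot_iff.1 this

lemma F0 [Finite G] [Fact p.Prime]
    (hne : ∃ a b : G, PEl p a ∧ PEl p b ∧ a ≠ 1 ∧ b ≠ 1 ∧ ¬ Conn p a b) (P : Sylow p G) :
    ∃ a ∈ P, ∃ b ∈ P, a ≠ 1 ∧ b ≠ 1 ∧ ¬ Conn p a b := by
  by_contra hcon
  push Not at hcon
  obtain ⟨a, b, ha, hb, ha1, hb1, hab⟩ := hne
  apply hab
  rcases padj_or ha hb with h | ⟨Q, haQ, hbQ⟩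
  · exact h.conn
  · obtain ⟨m, hm⟩ := sylow_conj Q P
    rw [← Conn.conj_iff m]
    exact hcon _ ((hm a).1 haQ) _ ((hm b).1 hbQ) (by simpa using ha1) (by simpa using hb1)

lemma lemmaN (hIH : IHsub p G) {H S : Subgroup G} (hH : H ≠ ⊤)
    (hS : IsPGroup p S) (hVS : OpIn p H ≤ S) (hSH : S ≤ H) {a : G} (haS : a ∈ S)
    (haV : a ∉ OpIn p H) :
    (∀ h ∈ H, h ∈ normalizer ((closure {s | s ∈ S ∧ ¬ Conn p a s} : Subgroup G) : Set G)) ∧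
    (∀ x, (∀ s, s ∈ S ↔ x * s * x⁻¹ ∈ S) →
      x ∈ normalizer ((closure {s | s ∈ S ∧ ¬ Conn p a s} : Subgroup G) : Set G)) := by
  set X : Set G := {s | s ∈ S ∧ ¬ Conn p a s} with hX
  have pS : ∀ s ∈ S, PEl p s := fun s hs => PEl.of_mem hS hs
  have key : ∀ g : G, (∀ s ∈ X, g * s * g⁻¹ ∈ X) → (∀ s ∈ X, g⁻¹ * s * g ∈ X) →
      g ∈ normalizer ((closure X : Subgroup G) : Set G) := by
    have aux : ∀ g : G, (∀ s ∈ X, g * s * g⁻¹ ∈ X) → ∀ y ∈ closure X, g * y * g⁻¹ ∈ closure X := by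
      intro g h y hy
      have : closure X ≤ (closure X).comap (MulAut.conj g).toMonoidHom := by
        rw [closure_le]
        intro s hs
        exact subset_closure (h s hs)
      exact this hy
    intro g h1 h2
    rw [mem_normalizer_iff]
    intro n
    refine ⟨aux g h1 n, fun h => ?_⟩
    have := aux g⁻¹ (by simpa using h2) _ h
    simpa [mul_assoc] using this
  have hXV : ∀ s ∈ X, s ∈ OpIn p H := by
    intro s hs
    by_contra hn
    exact hs.2 (hIH H hH a s (hSH haS) (hSH hs.1) (pS a haS) (pS s hs.1) haV hn)
  constructor
  · have h1 : ∀ h ∈ H, ∀ s ∈ X, h * s * h⁻¹ ∈ X := by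
      intro h hh s hs
      refine ⟨hVS (OpIn_nz hh (hXV s hs)), fun hc => hs.2 ?_⟩
      rw [← Conn.conj_iff h]
      refine Conn.trans ?_ hc
      refine hIH H hH _ _ (H.mul_mem (H.mul_mem hh (hSH haS)) (H.inv_mem hh)) (hSH haS)
        ((pS a haS).conj h) (pS a haS) ?_ haV
      rwa [OpIn_nz_iff hh]
    intro h hh
    refine key h (h1 h hh) ?_
    simpa using h1 h⁻¹ (H.inv_mem hh)
  · have h1 : ∀ x, (∀ s, s ∈ S ↔ x * s * x⁻¹ ∈ S) → ∀ s ∈ X, x * s * x⁻¹ ∈ X := by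
      intro x hx s hs
      have hax : Conn p a (x * a * x⁻¹) := by
        have hSV : ¬ S ≤ OpIn p H := fun h => haV (h haS)
        have hSV2 : ¬ S ≤ (OpIn p H).comap (MulAut.conj x⁻¹).toMonoidHom := by
          intro h
          apply haV
          have := h ((hx a).1 haS)
          simpa [mul_assoc] using this
        obtain ⟨c, hc, hc1, hc2⟩ := exists_not_mem_two hSV hSV2
        have hc3 : x⁻¹ * c * x ∉ OpIn p H := by simpa using hc2
        have hc4 : x⁻¹ * c * x ∈ S := by
          rw [hx]; simpa [mul_assoc] using hc
        have e1 : Conn p a c := hIH H hH _ _ (hSH haS) (hSH hc) (pS _ haS) (pS _ hc) haV hc1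
        have e2 : Conn p a (x⁻¹ * c * x) :=
          hIH H hH _ _ (hSH haS) (hSH hc4) (pS _ haS) (pS _ hc4) haV hc3
        have e3 := e2.conj x
        have e4 : x * (x⁻¹ * c * x) * x⁻¹ = c := by group
        rw [e4] at e3
        exact e1.trans e3.symm
      refine ⟨(hx s).1 hs.1, fun hc => hs.2 ?_⟩
      rw [← Conn.conj_iff x]
      exact hax.symm.trans hc
    intro x hx
    refine key x (h1 x hx) ?_
    have hx' : ∀ s, s ∈ S ↔ x⁻¹ * s * x⁻¹⁻¹ ∈ S := by
      intro s
      rw [hx (x⁻¹ * s * x⁻¹⁻¹)]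
      simp [mul_assoc]
    simpa using h1 x⁻¹ hx'

lemma fact2 [Finite G] [Fact p.Prime] (hIH : IHsub p G) (hO : Op p G = ⊥)
    (hne : ∃ a b : G, PEl p a ∧ PEl p b ∧ a ≠ 1 ∧ b ≠ 1 ∧ ¬ Conn p a b) (P : Sylow p G) :
    ∃ M : Subgroup G, M ≠ ⊤ ∧ (P : Subgroup G) ≤ M ∧
      (∀ H : Subgroup G, H ≠ ⊤ → (P : Subgroup G) ≤ H → H ≤ M) ∧
      ((∀ Q : Sylow p G, (Q : Subgroup G) ≤ M → Q = P) ∨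
        ∃ a0 ∈ P, a0 ≠ 1 ∧ ∀ m ∈ M, Conn p a0 (m * a0 * m⁻¹)) := by
  obtain ⟨a', ha', b', hb', ha1, hb1, hab⟩ := F0 hne P
  have hPb : (P : Subgroup G) ≠ ⊥ := by
    intro h
    have : a' ∈ (P : Subgroup G) := ha'
    rw [h] at this
    exact ha1 (by simpa using this)
  have hnormP : ∀ H : Subgroup G, (P : Subgroup G) ≤ H → (P : Subgroup G) ≤ OpIn p H →
      ∀ h ∈ H, ∀ s, s ∈ (P : Subgroup G) ↔ h * s * h⁻¹ ∈ (P : Subgroup G) := by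
    intro H hPH hPO h hh s
    have e : (P : Subgroup G) = OpIn p H := le_antisymm hPO (OpIn_le_sylow P hPH)
    rw [e, OpIn_nz_iff hh]
  by_cases hcase : ∀ H : Subgroup G, H ≠ ⊤ → (P : Subgroup G) ≤ H → (P : Subgroup G) ≤ OpIn p H
  · refine ⟨normalizer ((P : Subgroup G) : Set G), ?_, le_normalizer, ?_, Or.inl ?_⟩
    · intro h
      exact hPb (pgroup_normal_bot hO P.isPGroup' h)
    · intro H hH hPH h hh
      rw [mem_normalizer_iff]
      exact hnormP H hPH (hcase H hH hPH) h hh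
    · intro Q hQ
      have h1 : IsPGroup p ↥((Q : Subgroup G) ⊔ P) := sup_pgroup Q.isPGroup' P.isPGroup' (by
        intro s hs w hw
        exact ((mem_normalizer_iff.1 (hQ hs)) w).1 hw)
      have h2 := sylow_max P h1 le_sup_right
      have h3 : (P : Subgroup G) = Q := Q.is_maximal' P.isPGroup' (le_sup_left.trans h2)
      exact (Sylow.ext h3).symm
  · push Not at hcase
    obtain ⟨H, hH, hPH, hPO⟩ := hcase
    obtain ⟨a, haP, haO⟩ := SetLike.not_le_iff_exists.1 hPO
    have hN := lemmaN hIH hH P.isPGroup' (OpIn_le_sylow P hPH) hPH haP haO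
    set Y : Subgroup G := closure {s | s ∈ (P : Subgroup G) ∧ ¬ Conn p a s} with hY
    have hYP : Y ≤ P := by
      rw [hY, closure_le]; exact fun s hs => hs.1
    have hYb : Y ≠ ⊥ := by
      intro h
      have h1 : ∀ s ∈ P, s ≠ 1 → Conn p a s := by
        intro s hs hs1
        by_contra hc
        have : s ∈ Y := subset_closure ⟨hs, hc⟩
        rw [h] at this
        exact hs1 (by simpa using this)
      exact hab ((h1 a' ha' ha1).symm.trans (h1 b' hb' hb1))
    have hM : normalizer (Y : Set G) ≠ ⊤ := fun h =>
      hYb (pgroup_normal_bot hO (P.isPGroup'.to_le hYP) h)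
    have hHM : H ≤ normalizer (Y : Set G) := hN.1
    refine ⟨normalizer (Y : Set G), hM, hPH.trans hHM, ?_, Or.inr ?_⟩
    · intro H' hH' hPH'
      by_cases hPO' : (P : Subgroup G) ≤ OpIn p H'
      · intro h hh
        exact hN.2 h (hnormP H' hPH' hPO' h hh)
      · obtain ⟨c, hc, hc1, hc2⟩ := exists_not_mem_two hPO hPO'
        have hac : Conn p a c := hIH H hH a c (hPH haP) (hPH hc)
          (PEl.of_mem P.isPGroup' haP) (PEl.of_mem P.isPGroup' hc) haO hc1
        have hN' := lemmaN hIH hH' P.isPGroup' (OpIn_le_sylow P hPH') hPH' hc hc2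
        have e : {s | s ∈ (P : Subgroup G) ∧ ¬ Conn p c s} =
            {s | s ∈ (P : Subgroup G) ∧ ¬ Conn p a s} := by
          ext s
          refine and_congr_right fun _ => not_congr ⟨fun h => hac.trans h, fun h => hac.symm.trans h⟩
        rw [e] at hN'
        exact hN'.1
    · have hPM : ¬ (P : Subgroup G) ≤ OpIn p (normalizer (Y : Set G)) := by
        intro h
        apply hPO
        refine le_OpIn hPH P.isPGroup' ?_
        intro h' hh' w hw
        exact (hnormP _ (hPH.trans hHM) h h' (hHM hh') w).1 hw
      obtain ⟨c, hcP, hcO⟩ := SetLike.not_le_iff_exists.1 hPM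
      have pc := PEl.of_mem P.isPGroup' hcP
      have hcM := hHM (hPH hcP)
      refine ⟨c, hcP, fun h => hcO (h ▸ one_mem _), fun m hm => ?_⟩
      refine hIH _ hM _ _ hcM (mul_mem (mul_mem hm hcM) (inv_mem hm)) pc (pc.conj m) hcO ?_
      rwa [OpIn_nz_iff hm]

lemma exists_coatom [Finite G] {H : Subgroup G} (hH : H ≠ ⊤) :
    ∃ H' : Subgroup G, H ≤ H' ∧ H' ≠ ⊤ ∧ ∀ L, H' ≤ L → L ≠ ⊤ → L ≤ H' := by
  have hfin : {T : Subgroup G | H ≤ T ∧ T ≠ ⊤}.Finite := Set.toFinite _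
  obtain ⟨T, hT⟩ := hfin.exists_maximal ⟨H, le_rfl, hH⟩
  exact ⟨T, hT.1.1, hT.1.2, fun L h1 h2 => hT.2 ⟨hT.1.1.trans h1, h2⟩ h1⟩

lemma fact4 [Finite G] [Fact p.Prime] (hIH : IHsub p G) (hO : Op p G = ⊥)
    (hne : ∃ a b : G, PEl p a ∧ PEl p b ∧ a ≠ 1 ∧ b ≠ 1 ∧ ¬ Conn p a b)
    (M : Sylow p G → Subgroup G) (hM1 : ∀ P, M P ≠ ⊤) (hM2 : ∀ P : Sylow p G, (P : Subgroup G) ≤ M P)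
    (hM3 : ∀ (P : Sylow p G) (H : Subgroup G), H ≠ ⊤ → (P : Subgroup G) ≤ H → H ≤ M P)
    (hM4 : ∀ P : Sylow p G, (∀ Q : Sylow p G, (Q : Subgroup G) ≤ M P → Q = P) ∨
        ∃ a0 ∈ P, a0 ≠ 1 ∧ ∀ m ∈ M P, Conn p a0 (m * a0 * m⁻¹))
    (hM5 : ∀ P Q : Sylow p G, (Q : Subgroup G) ≤ M P → M Q = M P) (P : Sylow p G) :
    ∃ b ∈ P, b ≠ 1 ∧ ∀ Q : Sylow p G, b ∈ Q → (Q : Subgroup G) ≤ M P := by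
  by_contra hcon
  push Not at hcon
  have claim : ∀ a ∈ P, a ≠ 1 → ∃ P' : Sylow p G, (P' : Subgroup G) ≤ M P ∧
      ∀ z ∈ P', z ≠ 1 → (∀ q ∈ P', q * z = z * q) → Conn p a z := by
    intro a haP ha1
    obtain ⟨Q0, haQ0, hQ0⟩ := hcon a haP ha1
    have hfin : {x : Sylow p G × Sylow p G | (x.1 : Subgroup G) ≤ M P ∧
      ¬ (x.2 : Subgroup G) ≤ M P ∧ a ∈ x.1 ∧ a ∈ x.2}.Finite := Set.toFinite _
    obtain ⟨⟨P', Q⟩, ⟨hP'M, hQM, haP', haQ⟩, hmax⟩ := Set.exists_max_image _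
      (fun x : Sylow p G × Sylow p G => Nat.card ↥((x.1 : Subgroup G) ⊓ x.2)) hfin
      ⟨(P, Q0), hM2 P, hQ0, haP, haQ0⟩
    simp only at hP'M hQM haP' haQ hmax
    set T : Subgroup G := (P' : Subgroup G) ⊓ Q with hT
    have haT : a ∈ T := ⟨haP', haQ⟩
    have hTp : IsPGroup p T := P'.isPGroup'.to_le inf_le_left
    have big : ∀ (A B : Sylow p G), (A : Subgroup G) ≤ M P → ¬ (B : Subgroup G) ≤ M P →
        ∀ x, T ≤ A → T ≤ B → x ∈ A → x ∈ B → x ∉ T → False := by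
      intro A B hA hB x hTA hTB hxA hxB hxT
      have h1 := hmax (A, B) ⟨hA, hB, hTA haT, hTB haT⟩
      have h2 : T < (A : Subgroup G) ⊓ B := lt_of_le_of_ne (le_inf hTA hTB) (by
        intro h
        exact hxT (h ▸ (⟨hxA, hxB⟩ : x ∈ (A : Subgroup G) ⊓ B)))
      have h3 : Nat.card T < Nat.card ↥((A : Subgroup G) ⊓ B) := by
        by_contra h
        exact h2.ne (Subgroup.eq_of_le_of_card_ge h2.le (not_lt.1 h))
      simp only at h1
      omega
    have hPT : ¬ (P' : Subgroup G) ≤ T := by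
      intro h
      have h1 : (P' : Subgroup G) ≤ Q := h.trans inf_le_right
      have h2 : (Q : Subgroup G) = P' := P'.is_maximal' Q.isPGroup' h1
      exact hQM (h2 ▸ hP'M)
    have hQT : ¬ (Q : Subgroup G) ≤ T := by
      intro h
      exact hQM ((h.trans inf_le_left).trans hP'M)
    obtain ⟨x, hxP, hxT, hx⟩ := exists_normalizing P'.isPGroup' (inf_le_left : T ≤ P') hPT
    obtain ⟨y, hyQ, hyT, hy⟩ := exists_normalizing Q.isPGroup' (inf_le_right : T ≤ Q) hQT
    set H : Subgroup G := normalizer (T : Set G) with hH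
    have hHtop : H ≠ ⊤ := by
      intro h
      have := pgroup_normal_bot hO hTp h
      rw [this] at haT
      exact ha1 (by simpa using haT)
    have hTH : T ≤ H := le_normalizer
    have hxH : x ∈ H := by rw [hH, mem_normalizer_iff]; exact hx
    have hyH : y ∈ H := by rw [hH, mem_normalizer_iff]; exact hy
    -- the two p-subgroups
    set NP : Subgroup G := (P' : Subgroup G) ⊓ H with hNP
    set NQ : Subgroup G := (Q : Subgroup G) ⊓ H with hNQ
    have hNPp : IsPGroup p NP := P'.isPGroup'.to_le inf_le_left
    have hNQp : IsPGroup p NQ := Q.isPGroup'.to_le inf_le_left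
    have hTNP : T ≤ NP := le_inf inf_le_left hTH
    have hTNQ : T ≤ NQ := le_inf inf_le_right hTH
    have hα : ∀ R : Sylow p G, NQ ≤ R → ¬ (R : Subgroup G) ≤ M P := by
      intro R hR hRM
      exact big R Q hRM hQM y (hTNQ.trans hR) inf_le_right (hR ⟨hyQ, hyH⟩) hyQ hyT
    have hβ : ∀ R : Sylow p G, NP ≤ R → (R : Subgroup G) ≤ M P := by
      intro R hR
      by_contra hRM
      exact big P' R hP'M hRM x inf_le_left (hTNP.trans hR) hxP (hR ⟨hxP, hxH⟩) hxT
    have hγ : ∀ L : Subgroup G, H ≤ L → L ≠ ⊤ → ∀ R : Sylow p G, ¬ (R : Subgroup G) ≤ L := by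
      intro L hHL hL R hRL
      obtain ⟨R1, hR1, hR1L⟩ := sylow_of_subgroup R hRL hNPp (inf_le_right.trans hHL)
      obtain ⟨R2, hR2, hR2L⟩ := sylow_of_subgroup R hRL hNQp (inf_le_right.trans hHL)
      have h1 := hM3 R1 L hL hR1L
      rw [hM5 P R1 (hβ R1 hR1)] at h1
      exact hα R2 hR2 (hR2L.trans h1)
    obtain ⟨H', hHH', hH'top, hH'max⟩ := exists_coatom hHtop
    have hact : ∃ N : Subgroup G, IsPGroup p N ∧ N ≤ H' ∧ ¬ N ≤ OpIn p H' := by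
      by_contra hc
      push Not at hc
      have h1 := hc NP hNPp (inf_le_right.trans hHH')
      have h2 := hc NQ hNQp (inf_le_right.trans hHH')
      obtain ⟨R, hR⟩ := (OpIn_pgroup (p := p) (H := H')).exists_le_sylow
      exact hα R (h2.trans hR) (hβ R (h1.trans hR))
    obtain ⟨N, hNp, hNH', hNO⟩ := hact
    obtain ⟨S, hSp, hSH', hNS, hSmax⟩ := exists_max_pgroup hNp hNH'
    have hOS : OpIn p H' ≤ S := OpIn_le_of_max hSp hSH' hSmax
    obtain ⟨a1, ha1N, ha1O⟩ := SetLike.not_le_iff_exists.1 hNO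
    have ha1S := hNS ha1N
    obtain ⟨R, hSR⟩ := hSp.exists_le_sylow
    have hRS : ¬ (R : Subgroup G) ≤ S := fun h => hγ H' hHH' hH'top R (h.trans hSH')
    obtain ⟨w, hwR, hwS, hw⟩ := exists_normalizing R.isPGroup' hSR hRS
    have hwH' : w ∉ H' := by
      intro h
      exact hwS (hSmax ((R : Subgroup G) ⊓ H') (R.isPGroup'.to_le inf_le_left) inf_le_right
        (le_inf hSR hSH') ⟨hwR, h⟩)
    have hN := lemmaN hIH hH'top hSp hOS hSH' ha1S ha1O
    set Y : Subgroup G := closure {s | s ∈ S ∧ ¬ Conn p a1 s} with hY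
    have hYS : Y ≤ S := by rw [hY, closure_le]; exact fun s hs => hs.1
    have hYbot : Y = ⊥ := by
      apply pgroup_normal_bot hO (hSp.to_le hYS)
      by_contra hc
      exact hwH' (hH'max _ hN.1 hc (hN.2 w hw))
    have hall : ∀ s ∈ H', PEl p s → s ≠ 1 → Conn p a1 s := by
      intro s hs ps hs1
      by_cases hsO : s ∈ OpIn p H'
      · by_contra hc
        have : s ∈ Y := subset_closure ⟨hOS hsO, hc⟩
        rw [hYbot] at this
        exact hs1 (by simpa using this)
      · exact hIH H' hH'top _ _ (hSH' ha1S) hs (PEl.of_mem hSp ha1S) ps ha1O hsO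
    refine ⟨P', hP'M, fun z hz hz1 hzc => ?_⟩
    have hzH : z ∈ H := by
      rw [hH, mem_normalizer_iff]
      have : ∀ t ∈ T, z * t * z⁻¹ = t := by
        intro t ht
        rw [← hzc t ht.1]; group
      intro t
      refine ⟨fun ht => by rw [this t ht]; exact ht, fun ht => ?_⟩
      have h1 : z * (z * t * z⁻¹) * z⁻¹ = z * t * z⁻¹ := this _ ht
      have h2 : z * t * z⁻¹ = t := by
        have h5 := congrArg (fun u => z⁻¹ * u * z) h1
        simpa [mul_assoc] using h5
      rw [h2] at ht; exact ht
    exact (hall a (hHH' (hTH haT)) (PEl.of_mem hTp haT) ha1).symm.trans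
      (hall z (hHH' hzH) (PEl.of_mem P'.isPGroup' hz) hz1)
  obtain ⟨a', ha', b', hb', ha1, hb1, hab⟩ := F0 hne P
  have hPb : (P : Subgroup G) ≠ ⊥ := by
    intro h
    have : a' ∈ (P : Subgroup G) := ha'
    rw [h] at this
    exact ha1 (by simpa using this)
  obtain ⟨z0, hz0, hz01, hz0c⟩ := exists_center P.isPGroup' hPb
  suffices ∃ t : G, ∀ a ∈ P, a ≠ 1 → Conn p a t by
    obtain ⟨t, ht⟩ := this
    exact hab ((ht a' ha' ha1).trans (ht b' hb' hb1).symm)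
  rcases hM4 P with huniq | ⟨a0, ha0, ha01, hconj⟩
  · refine ⟨z0, fun a ha ha1 => ?_⟩
    obtain ⟨P', hP', h⟩ := claim a ha ha1
    rw [huniq P' hP'] at h
    exact h z0 hz0 hz01 hz0c
  · have hstep : ∀ a ∈ P, a ≠ 1 → ∃ m ∈ M P, Conn p a (m * z0 * m⁻¹) := by
      intro a ha ha1
      obtain ⟨P', hP', h⟩ := claim a ha ha1
      obtain ⟨m, hm, hmm⟩ := sylow_conj_in P P' (hM2 P) hP'
      refine ⟨m, hm, h _ ((hmm z0).1 hz0) (by simpa using hz01) ?_⟩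
      intro q hq
      have h1 : m⁻¹ * q * m ∈ P := by rw [hmm]; simpa [mul_assoc] using hq
      have h2 := hz0c _ h1
      have h3 : q = m * (m⁻¹ * q * m) * m⁻¹ := by group
      rw [h3]
      have h4 := congrArg (fun t => m * t * m⁻¹) h2
      simpa [mul_assoc] using h4
    obtain ⟨n, hn, hnz⟩ := hstep a0 ha0 ha01
    have e1 : Conn p a0 z0 := by
      have h1 := hconj n hn
      rw [← Conn.conj_iff n]
      exact h1.symm.trans hnz
    refine ⟨a0, fun a ha ha1 => ?_⟩
    obtain ⟨m, hm, hmz⟩ := hstep a ha ha1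
    exact (hmz.trans (e1.conj m).symm).trans (hconj m hm).symm

lemma thmP_core [Finite G] [Fact p.Prime] (hIH : IHsub p G) (hO : Op p G = ⊥)
    (hne : ∃ a b : G, PEl p a ∧ PEl p b ∧ a ≠ 1 ∧ b ≠ 1 ∧ ¬ Conn p a b) : False := by
  choose M hM1 hM2 hM3 hM4 using fact2 hIH hO hne
  have hM5 : ∀ P Q : Sylow p G, (Q : Subgroup G) ≤ M P → M Q = M P := by
    intro P Q h
    have h1 := hM3 Q (M P) (hM1 P) h
    exact le_antisymm (hM3 P _ (hM1 Q) ((hM2 P).trans h1)) h1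
  obtain ⟨P⟩ : Nonempty (Sylow p G) := inferInstance
  obtain ⟨b, hbP, hb1, hb⟩ := fact4 hIH hO hne M hM1 hM2 hM3 hM4 hM5 P
  have pb : PEl p b := PEl.of_mem P.isPGroup' hbP
  have hbM : b ∈ M P := hM2 P hbP
  have conjtop : ∀ g : G, (M P).map (MulAut.conj g).toMonoidHom ≠ ⊤ := by
    intro g h
    apply hM1 P
    apply Subgroup.eq_top_of_card_eq
    rw [← Subgroup.card_map_of_injective (f := (MulAut.conj g).toMonoidHom) (MulAut.conj g).injective,
      h, Subgroup.card_top]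
  -- (1)
  have s1 : ∀ q, PEl p q → q ∉ M P → Conn p b q := by
    intro q pq hq
    rcases padj_or pb pq with h | ⟨Q, hQ1, hQ2⟩
    · exact h.conn
    · exact absurd (hb Q hQ1 hQ2) hq
  -- a Sylow subgroup inside both `M` and a conjugate
  have s0 : ∀ (g : G) (R : Sylow p G), (R : Subgroup G) ≤ M P →
      (∀ r ∈ R, g⁻¹ * r * g ∈ M P) → ∀ m ∈ M P, g * m * g⁻¹ ∈ M P := by
    intro g R hR hRg m hm
    have h1 := hM3 R _ (conjtop g) (by
      intro r hr
      exact ⟨g⁻¹ * r * g, hRg r hr, by simp [mul_assoc]⟩)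
    rw [hM5 P R hR] at h1
    exact h1 ⟨m, hm, rfl⟩
  -- (2)
  have s2 : ∀ g : G, g * b * g⁻¹ ∈ M P → ∀ m ∈ M P, g * m * g⁻¹ ∈ M P := by
    intro g hg
    obtain ⟨R, hR1, hR2⟩ := sylow_of_subgroup P (hM2 P) (pb.conj g).zpowers
      (by rw [zpowers_le]; exact hg)
    refine s0 g R hR2 ?_
    have h3 : b ∈ (g⁻¹ • R : Sylow p G) := by
      have : b ∈ ((g⁻¹ • R : Sylow p G) : Subgroup G) := by
        rw [Sylow.coe_subgroup_smul, Subgroup.mem_pointwise_smul_iff_inv_smul_mem]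
        simpa using hR1 (mem_zpowers _)
      exact this
    intro r hr
    apply hb _ h3
    rw [Sylow.coe_subgroup_smul, Subgroup.mem_pointwise_smul_iff_inv_smul_mem]
    have hr' : r ∈ (R : Subgroup G) := hr
    simpa [mul_assoc] using hr'
  -- (3)
  have s3 : ∀ z, PEl p z → ¬ Conn p b z → z ∈ (M P).normalCore := by
    intro z pz hz g
    by_contra hg
    have hzM : z ∈ M P := by
      by_contra h
      exact hz (s1 z pz h)
    have h1 : Conn p b (g * z * g⁻¹) := s1 _ (pz.conj g) hg
    by_cases h2 : g⁻¹ * b * g⁻¹⁻¹ ∈ M P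
    · have h3 := s2 g⁻¹ h2
      have h4 := s0 g P (hM2 P) (fun r hr => by simpa using h3 r (hM2 P hr))
      exact hg (h4 z hzM)
    · have h3 := s1 _ (pb.conj g⁻¹) h2
      apply hz
      refine h3.trans ?_
      have := h1.conj g⁻¹
      simpa [mul_assoc] using this
  obtain ⟨u, v, pu, pv, hu1, hv1, huv⟩ := hne
  obtain ⟨z0, pz0, hz01, hz0⟩ : ∃ z0, PEl p z0 ∧ z0 ≠ 1 ∧ ¬ Conn p b z0 := by
    by_cases h : Conn p b u
    · exact ⟨v, pv, hv1, fun h' => huv (h.symm.trans h')⟩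
    · exact ⟨u, pu, hu1, h⟩
  set N0 := (M P).normalCore with hN0
  have hN0M : N0 ≤ M P := normalCore_le _
  have hN0n : N0.Normal := normalCore_normal _
  have hON0 : OpIn p N0 = ⊥ := by
    apply pgroup_normal_bot hO OpIn_pgroup
    rw [normalizer_eq_top_iff]
    exact ⟨fun n hn g => OpIn_conj_nz hN0n hn⟩
  have hint : ∀ t, t ∈ N0 → t ∈ OpIn p (M P) → t = 1 := by
    intro t h1 h2
    have h3 : N0 ⊓ OpIn p (M P) ≤ OpIn p N0 := by
      refine le_OpIn inf_le_left (OpIn_pgroup.to_le inf_le_right) ?_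
      intro h hh w hw
      exact ⟨hN0n.conj_mem _ hw.1 h, OpIn_nz (hN0M hh) hw.2⟩
    have h4 := h3 ⟨h1, h2⟩
    rw [hON0] at h4
    simpa using h4
  have hz0N := s3 z0 pz0 hz0
  have hz0O : z0 ∉ OpIn p (M P) := fun h => hz01 (hint z0 hz0N h)
  have hbO : b ∈ OpIn p (M P) := by
    by_contra h
    exact hz0 (hIH (M P) (hM1 P) _ _ hbM (hN0M hz0N) pb pz0 h hz0O)
  have hcomm : Commute b z0 := by
    have h1 : b * z0 * b⁻¹ * z0⁻¹ ∈ N0 := mul_mem (hN0n.conj_mem _ hz0N b) (inv_mem hz0N)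
    have h2 : b * (z0 * b⁻¹ * z0⁻¹) ∈ OpIn p (M P) :=
      mul_mem hbO (OpIn_nz (hN0M hz0N) (inv_mem hbO))
    have h3 : b * z0 * b⁻¹ * z0⁻¹ = 1 := hint _ h1 (by simpa [mul_assoc] using h2)
    have h4 : b * z0 = z0 * b := by
      have := congrArg (fun t => t * z0 * b) h3
      simpa [mul_assoc] using this
    exact h4
  have pbz : PEl p (b * z0) := pb.mul_comm pz0 hcomm
  by_cases h : Conn p b (b * z0)
  · have h1 : b * z0 ∉ OpIn p (M P) := fun h' => hz0O ((mul_mem_cancel_left hbO).1 h')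
    have h2 := hIH (M P) (hM1 P) _ _ (mul_mem hbM (hN0M hz0N)) (hN0M hz0N) pbz pz0 h1 hz0O
    exact hz0 (h.trans h2)
  · have h1 := s3 _ pbz h
    exact hb1 (hint b ((mul_mem_cancel_right hz0N).1 h1) hbO)

lemma neighbour [Finite K] [Fact p.Prime] (hO : Op p K = ⊥)
    (hall : ∀ a b : K, PEl p a → PEl p b → a ≠ 1 → b ≠ 1 → Conn p a b) (k : K) (pk : PEl p k)
    (hk : k ≠ 1) : ∃ k', padj p k k' := by
  by_contra hc
  push Not at hc
  have hc2 : ∀ k', ¬ padj p k' k := by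
    intro k' h
    refine hc k' ⟨h.2.1, h.1, ?_⟩
    rw [Set.pair_comm]; exact h.2.2
  have h1 : ∀ g, g * k * g⁻¹ = k := by
    intro g
    have := hall k (g * k * g⁻¹) pk (pk.conj g) hk (by simpa using hk) {k} (by
      intro x y hxy
      simp only [Set.mem_singleton_iff]
      constructor
      · rintro rfl; exact absurd hxy (hc y)
      · rintro rfl; exact absurd hxy (hc2 x))
    simpa using this
  have h2 : (zpowers k).Normal := by
    constructor
    intro n hn g
    obtain ⟨i, rfl⟩ := mem_zpowers_iff.1 hn
    rw [← conj_zpow, h1]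
    exact hn
  have h3 := le_Op pk.zpowers h2
  rw [hO] at h3
  exact hk (by simpa using h3 (mem_zpowers k))

lemma Op_quot (p : ℕ) (G : Type u) [Group G] (V : Subgroup G) [V.Normal] (hV : V = Op p G) :
    Op p (G ⧸ V) = ⊥ := by
  have h1 : IsPGroup p ((Op p (G ⧸ V)).comap (QuotientGroup.mk' V)) := by
    apply Op_pgroup.comap_of_ker_isPGroup
    rw [QuotientGroup.ker_mk', hV]
    exact Op_pgroup
  have h2 := le_Op h1 (Op_normal.comap _)
  rw [← hV] at h2
  rw [eq_bot_iff]
  intro x hx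
  obtain ⟨y, rfl⟩ := QuotientGroup.mk'_surjective V x
  have h3 : y ∈ V := h2 hx
  simpa [QuotientGroup.eq_one_iff] using h3

lemma PEl.of_quot {V : Subgroup G} [V.Normal] (hV : IsPGroup p V) {g : G}
    (h : PEl p (g : G ⧸ V)) : PEl p g := by
  obtain ⟨k, hk⟩ := h
  rw [← QuotientGroup.mk_pow, QuotientGroup.eq_one_iff] at hk
  obtain ⟨l, hl⟩ := PEl.of_mem hV hk
  exact ⟨k + l, by rw [pow_add, pow_mul, hl]⟩

theorem thmP_aux (p : ℕ) [Fact p.Prime] : ∀ n : ℕ, ∀ (G : Type u) [Group G] [Finite G],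
    Nat.card G = n → ∀ a b : G, PEl p a → PEl p b → a ∉ Op p G → b ∉ Op p G → Conn p a b := by
  intro n
  induction n using Nat.strong_induction_on with
  | _ n ih =>
  intro G _ _ hn a b pa pb ha hb
  by_cases hO : Op p G = ⊥
  · have hIH : IHsub p G := by
      intro H hH a b ha hb pa pb haO hbO
      have hc : Nat.card H < n := by
        rw [← hn]
        refine lt_of_le_of_ne (Nat.le_of_dvd Nat.card_pos (card_subgroup_dvd_card H)) fun h => hH ?_
        exact Subgroup.eq_top_of_card_eq _ h
      have := ih _ hc H rfl ⟨a, ha⟩ ⟨b, hb⟩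
        (PEl.of_map H.subtype (subtype_injective H) pa)
        (PEl.of_map H.subtype (subtype_injective H) pb)
        (fun h => haO ⟨_, h, rfl⟩) (fun h => hbO ⟨_, h, rfl⟩)
      exact this.map H.subtype (subtype_injective H)
    by_contra hcon
    rw [hO] at ha hb
    exact thmP_core hIH hO ⟨a, b, pa, pb, by simpa using ha, by simpa using hb, hcon⟩
  · have hVn : (Op p G).Normal := Op_normal
    have hOq : Op p (G ⧸ Op p G) = ⊥ := Op_quot p G (Op p G) rfl
    have hc : Nat.card (G ⧸ Op p G) < n := by
      rw [← hn, Subgroup.card_eq_card_quotient_mul_card_subgroup (Op p G)]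
      have h1 : 1 < Nat.card (Op p G) := (Subgroup.one_lt_card_iff_ne_bot _).2 hO
      have h2 : 0 < Nat.card (G ⧸ Op p G) := Nat.card_pos
      nlinarith
    have hall : ∀ a b : G ⧸ Op p G, PEl p a → PEl p b → a ≠ 1 → b ≠ 1 → Conn p a b := by
      intro a b pa pb ha hb
      exact ih _ hc _ rfl a b pa pb (by rw [hOq]; simpa using ha) (by rw [hOq]; simpa using hb)
    have lift : ∀ x y : G, padj p (x : G ⧸ Op p G) (y : G ⧸ Op p G) → padj p x y := by
      intro x y h
      refine ⟨PEl.of_quot Op_pgroup h.1, PEl.of_quot Op_pgroup h.2.1, fun hh => h.2.2 ?_⟩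
      have h1 : closure {(x : G ⧸ Op p G), (y : G ⧸ Op p G)} =
          (closure {x, y}).map (QuotientGroup.mk' (Op p G)) := by
        rw [MonoidHom.map_closure, Set.image_pair]; rfl
      rw [h1]
      exact hh.map _
    have main : ∀ (A : Set G), (∀ x y, padj p x y → (x ∈ A ↔ y ∈ A)) → ∀ a b : G, PEl p a → PEl p b →
        a ∉ Op p G → b ∉ Op p G → a ∈ A → b ∈ A := by
      intro A hA a b pa pb ha hb haA
      have h1 : (b : G ⧸ Op p G) ∈ {k : G ⧸ Op p G | ∃ x : G, x ∈ A ∧ (x : G ⧸ Op p G) = k} := by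
        refine (hall (a : G ⧸ Op p G) b (pa.map (QuotientGroup.mk' _)) (pb.map (QuotientGroup.mk' _))
          (by rwa [Ne, QuotientGroup.eq_one_iff]) (by rwa [Ne, QuotientGroup.eq_one_iff]) _ ?_).1
          ⟨a, haA, rfl⟩
        intro k k' hkk
        constructor
        · rintro ⟨x, hxA, rfl⟩
          obtain ⟨y, rfl⟩ := QuotientGroup.mk_surjective k'
          exact ⟨y, (hA x y (lift x y hkk)).1 hxA, rfl⟩
        · rintro ⟨x, hxA, rfl⟩
          obtain ⟨y, rfl⟩ := QuotientGroup.mk_surjective k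
          exact ⟨y, (hA y x (lift y x hkk)).2 hxA, rfl⟩
      obtain ⟨x, hxA, hxb⟩ := h1
      obtain ⟨k', hk'⟩ := neighbour hOq hall (b : G ⧸ Op p G) (pb.map (QuotientGroup.mk' _))
        (by rwa [Ne, QuotientGroup.eq_one_iff])
      obtain ⟨y, rfl⟩ := QuotientGroup.mk_surjective k'
      have h2 := hA _ _ (lift b y hk')
      have h3 := hA _ _ (lift x y (hxb ▸ hk'))
      exact h2.2 (h3.1 hxA)
    intro A hA
    exact ⟨main A hA a b pa pb ha hb, main A hA b a pb pa hb ha⟩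

theorem thmP (p : ℕ) [Fact p.Prime] {G : Type u} [Group G] [Finite G] {a b : G}
    (ha : PEl p a) (hb : PEl p b) (ha' : a ∉ Op p G) (hb' : b ∉ Op p G) : Conn p a b :=
  thmP_aux p _ G rfl a b ha hb ha' hb'

end ThmP
end NSG

namespace NSG
open Subgroup

section LemmaF
variable {p : ℕ} {G : Type u} [Group G]

lemma lang_inj {d : G} {S : Subgroup G}
    (h : ∀ c ∈ S, d * c = c * d → c = 1) {s t : G} (hs : s ∈ S) (ht : t ∈ S)
    (e : s⁻¹ * (d * s * d⁻¹) = t⁻¹ * (d * t * d⁻¹)) : s = t := by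
  have h1 : t * s⁻¹ = 1 := by
    apply h _ (mul_mem ht (inv_mem hs))
    have h2 := congrArg (fun u => t * u * d * s⁻¹) e
    have h3 : t * (s⁻¹ * (d * s * d⁻¹)) * d * s⁻¹ = t * s⁻¹ * d := by group
    have h4 : t * (t⁻¹ * (d * t * d⁻¹)) * d * s⁻¹ = d * (t * s⁻¹) := by group
    exact h4.symm.trans (h2.symm.trans h3)
  exact (mul_inv_eq_one.1 h1).symm

lemma lang_surj [Finite G] {d : G} {S : Subgroup G} (hd : ∀ s ∈ S, d * s * d⁻¹ ∈ S)
    (h : ∀ c ∈ S, d * c = c * d → c = 1) :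
    ∀ s ∈ S, ∃ t ∈ S, s = t⁻¹ * (d * t * d⁻¹) := by
  let f : S → S := fun t => ⟨(t : G)⁻¹ * (d * t * d⁻¹), mul_mem (inv_mem t.2) (hd _ t.2)⟩
  have hf : Function.Injective f := by
    intro s t hst
    exact Subtype.ext (lang_inj h s.2 t.2 (congrArg Subtype.val hst))
  intro s hs
  obtain ⟨t, ht⟩ := (Finite.injective_iff_surjective.1 hf) ⟨s, hs⟩
  exact ⟨t, t.2, (congrArg Subtype.val ht).symm⟩

lemma lang_of_surj [Finite G] {d : G} {S : Subgroup G} (hd : ∀ s ∈ S, d * s * d⁻¹ ∈ S)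
    (h : ∀ s ∈ S, ∃ t ∈ S, s = t⁻¹ * (d * t * d⁻¹)) :
    ∀ c ∈ S, d * c = c * d → c = 1 := by
  let f : S → S := fun t => ⟨(t : G)⁻¹ * (d * t * d⁻¹), mul_mem (inv_mem t.2) (hd _ t.2)⟩
  have hf : Function.Surjective f := by
    intro s
    obtain ⟨t, ht, e⟩ := h s s.2
    exact ⟨⟨t, ht⟩, Subtype.ext e.symm⟩
  have hi := Finite.injective_iff_surjective.2 hf
  intro c hc hcd
  have : f ⟨c, hc⟩ = f 1 := by
    apply Subtype.ext
    simp [f, hcd]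
  simpa using congrArg Subtype.val (hi this)

lemma conj_iff_of_conj [Finite G] {d : G} {T : Subgroup G} (h : ∀ t ∈ T, d * t * d⁻¹ ∈ T) (t : G) :
    t ∈ T ↔ d * t * d⁻¹ ∈ T := by
  refine ⟨h t, fun ht => ?_⟩
  have e : T.map (MulAut.conj d).toMonoidHom = T := by
    apply Subgroup.eq_of_le_of_card_ge
    · rintro _ ⟨y, hy, rfl⟩; exact h y hy
    · rw [Subgroup.card_map_of_injective (MulAut.conj d).injective]
  rw [← e] at ht
  obtain ⟨y, hy, hye⟩ := ht
  have : y = t := by simpa using hye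
  exact this ▸ hy

theorem lemmaF [Finite G] [Fact p.Prime] (d : G)
    (h1 : ∀ w : G, PEl p w → ∃ T : Subgroup G, IsPGroup p T ∧ w ∈ T ∧ ∀ t ∈ T, d * t * d⁻¹ ∈ T)
    (h2 : ∀ w : G, PEl p w → d * w = w * d → w = 1) :
    ∀ w : G, PEl p w → w ∈ Op p G := by
  set K : Subgroup G := closure {w | PEl p w} with hK
  have hKn : ∀ g, ∀ k ∈ K, g * k * g⁻¹ ∈ K := by
    intro g k hk
    have : K ≤ K.comap (MulAut.conj g).toMonoidHom := by
      rw [hK, closure_le]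
      intro w hw
      have hw' : PEl p w := hw
      exact subset_closure (hw'.conj g)
    exact this hk
  have pK : ∀ w, PEl p w → w ∈ K := fun w hw => subset_closure hw
  have hstep : ∀ w, PEl p w → ∀ k t, t ∈ K → k = t⁻¹ * (d * t * d⁻¹) →
      ∃ t' ∈ K, w * k = t'⁻¹ * (d * t' * d⁻¹) := by
    intro w pw k t ht hk
    obtain ⟨T, hT, hwT, hdT⟩ := h1 _ (pw.conj t)
    obtain ⟨s, hs, hse⟩ := lang_surj hdT (fun c hc hcd => h2 c (PEl.of_mem hT hc) hcd) _ hwT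
    refine ⟨s * t, mul_mem (pK s (PEl.of_mem hT hs)) ht, ?_⟩
    rw [hk]
    have : w = t⁻¹ * (s⁻¹ * (d * s * d⁻¹)) * t := by rw [← hse]; group
    rw [this]; group
  have hKs : ∀ k ∈ K, ∃ t ∈ K, k = t⁻¹ * (d * t * d⁻¹) := by
    intro k hk
    induction hk using closure_induction_left with
    | one => exact ⟨1, one_mem _, by simp⟩
    | mul_left x hx y hy ih =>
      obtain ⟨t, ht, e⟩ := ih
      exact hstep x hx y t ht e
    | inv_mul_cancel x hx y hy ih =>
      obtain ⟨t, ht, e⟩ := ih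
      have hx' : PEl p x := hx
      exact hstep x⁻¹ hx'.inv y t ht e
  have hKc := lang_of_surj (hKn d) hKs
  -- every p-element is in a d-invariant Sylow subgroup
  have hSyl : ∀ w, PEl p w → ∃ P : Sylow p G, w ∈ P ∧ ∀ t ∈ P, d * t * d⁻¹ ∈ P := by
    intro w pw
    have hfin : {T : Subgroup G | IsPGroup p T ∧ w ∈ T ∧ ∀ t ∈ T, d * t * d⁻¹ ∈ T}.Finite :=
      Set.toFinite _
    obtain ⟨T, hT⟩ := hfin.exists_maximal (h1 w pw)
    obtain ⟨⟨hTp, hwT, hTd⟩, hTmax⟩ := hT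
    obtain ⟨R, hTR⟩ := hTp.exists_le_sylow
    by_cases hRT : (R : Subgroup G) ≤ T
    · have e : (R : Subgroup G) = T := le_antisymm hRT hTR
      refine ⟨R, hTR hwT, fun t ht => ?_⟩
      have : t ∈ (R : Subgroup G) := ht
      rw [e] at this
      exact hTR (hTd t this)
    · exfalso
      obtain ⟨x, hxR, hxT, hx⟩ := exists_normalizing R.isPGroup' hTR hRT
      obtain ⟨T', hT'p, hxT', hT'd⟩ := h1 x (PEl.of_mem R.isPGroup' hxR)
      have hdN : d ∈ normalizer (T : Set G) := by
        rw [mem_normalizer_iff]; exact conj_iff_of_conj hTd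
      have hp : IsPGroup p ↥((T' ⊓ normalizer (T : Set G)) ⊔ T) := by
        refine sup_pgroup (hT'p.to_le inf_le_left) hTp ?_
        intro s hs w hw
        exact ((mem_normalizer_iff.1 hs.2) w).1 hw
      have hle : (T' ⊓ normalizer (T : Set G)) ⊔ T ≤
          ((T' ⊓ normalizer (T : Set G)) ⊔ T).comap (MulAut.conj d).toMonoidHom := by
        refine sup_le ?_ ?_
        · intro s hs
          exact mem_sup_left (show d * s * d⁻¹ ∈ _ from
            mem_inf.2 ⟨hT'd s hs.1, mul_mem (mul_mem hdN (mem_inf.1 hs).2) (inv_mem hdN)⟩)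
        · intro s hs
          exact mem_sup_right (show d * s * d⁻¹ ∈ _ from hTd s hs)
      have := hTmax (y := (T' ⊓ normalizer (T : Set G)) ⊔ T)
        ⟨hp, mem_sup_right hwT, fun t ht => hle ht⟩ le_sup_right
      exact hxT (this (mem_sup_left (mem_inf.2 ⟨hxT', by rw [mem_normalizer_iff]; exact hx⟩)))
  have huniq : ∀ P Q : Sylow p G, (∀ t ∈ P, d * t * d⁻¹ ∈ P) → (∀ t ∈ Q, d * t * d⁻¹ ∈ Q) →
      Q = P := by
    intro P Q hP hQ
    have hle : ∀ P : Sylow p G, (P : Subgroup G) ≤ K := fun P g hg =>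
      pK g (PEl.of_mem P.isPGroup' hg)
    obtain ⟨k, hkK, hk⟩ := sylow_conj_in P Q (hle P) (hle Q)
    have hPi := conj_iff_of_conj (T := (P : Subgroup G)) hP
    have hQi := conj_iff_of_conj (T := (Q : Subgroup G)) hQ
    have hk' : ∀ g, g ∈ (P : Subgroup G) ↔ k * g * k⁻¹ ∈ (Q : Subgroup G) := hk
    have hdN : d ∈ normalizer ((P : Subgroup G) : Set G) := by
      rw [mem_normalizer_iff]; exact hPi
    have hc : k⁻¹ * (d * k * d⁻¹) ∈ K ⊓ normalizer ((P : Subgroup G) : Set G) := by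
      refine mem_inf.2 ⟨mul_mem (inv_mem hkK) (hKn d k hkK), ?_⟩
      rw [mem_normalizer_iff]
      intro g
      rw [hk' (k⁻¹ * (d * k * d⁻¹) * g * (k⁻¹ * (d * k * d⁻¹))⁻¹)]
      have h5 : g ∈ (P : Subgroup G) ↔ d⁻¹ * g * d ∈ (P : Subgroup G) := by
        rw [hPi (d⁻¹ * g * d)]; simp [mul_assoc]
      rw [h5]
      rw [hk', hQi]
      have : d * (k * (d⁻¹ * g * d) * k⁻¹) * d⁻¹ =
        k * (k⁻¹ * (d * k * d⁻¹) * g * (k⁻¹ * (d * k * d⁻¹))⁻¹) * k⁻¹ := by group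
      rw [this]
    obtain ⟨n, hn, hne⟩ := lang_surj (d := d) (S := K ⊓ normalizer ((P : Subgroup G) : Set G))
      (fun s hs => mem_inf.2 ⟨hKn d s hs.1, mul_mem (mul_mem hdN (mem_inf.1 hs).2) (inv_mem hdN)⟩)
      (fun c hc hcd => hKc c hc.1 hcd) _ hc
    have hkn : k = n := lang_inj hKc hkK hn.1 hne
    have hkN := (mem_inf.1 hn).2
    rw [← hkn, mem_normalizer_iff] at hkN
    apply Sylow.ext
    ext g
    have h3 := hkN (k⁻¹ * g * k)
    have h4 := hk' (k⁻¹ * g * k)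
    have e : k * (k⁻¹ * g * k) * k⁻¹ = g := by group
    rw [e] at h3 h4
    exact h4.symm.trans h3
  intro w pw
  obtain ⟨P, hwP, hPd⟩ := hSyl w pw
  have hall : ∀ v, PEl p v → v ∈ P := by
    intro v pv
    obtain ⟨Q, hvQ, hQd⟩ := hSyl v pv
    rw [← huniq P Q hPd hQd]
    exact hvQ
  rw [Op, mem_iInf]
  intro Q
  have h3 : (Q : Subgroup G) ≤ P := fun g hg => hall g (PEl.of_mem Q.isPGroup' hg)
  have h4 : (P : Subgroup G) = Q := Q.is_maximal' P.isPGroup' h3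
  rw [← h4]; exact hwP

end LemmaF
end NSG

namespace NSG
open Subgroup Relation

section SS
variable {X : Type u} [Group X] {Y : Type u} [Group Y]

def CycStep (A B : Subgroup X) : Prop :=
  A.Normal ∧ B.Normal ∧ A ≤ B ∧ ∃ b ∈ B, B ≤ A ⊔ zpowers b

lemma rtg_seq {α : Type u} {r : α → α → Prop} {a b : α} (h : ReflTransGen r a b) :
    ∃ (k : ℕ) (H : ℕ → α), H 0 = a ∧ H k = b ∧ ∀ i < k, r (H i) (H (i + 1)) := by
  induction h with
  | refl => exact ⟨0, fun _ => a, rfl, rfl, fun i hi => absurd hi (by omega)⟩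
  | @tail b c hab hbc ih =>
    obtain ⟨k, H, h0, hk, hs⟩ := ih
    refine ⟨k + 1, fun i => if i ≤ k then H i else c, by simp [h0], by simp, fun i hi => ?_⟩
    by_cases h : i < k
    · have h1 : i ≤ k := by omega
      have h2 : i + 1 ≤ k := by omega
      simp only [h1, h2, if_true]
      exact hs i h
    · have h1 : i = k := by omega
      subst h1
      simp only [le_refl, if_true]
      rw [if_neg (by omega), hk]
      exact hbc

lemma cyclicFactor_iff (A B : Subgroup X) (hA : A.Normal) :
    CyclicFactor A B hA ↔ ∃ b ∈ B, B ≤ A ⊔ zpowers b := by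
  have hn : (A.subgroupOf B).Normal := hA.subgroupOf B
  have e : CyclicFactor A B hA ↔ IsCyclic (↥B ⧸ A.subgroupOf B) := Iff.rfl
  rw [e]
  constructor
  · intro h
    obtain ⟨g, hg⟩ := IsCyclic.exists_generator (α := ↥B ⧸ A.subgroupOf B)
    obtain ⟨b, rfl⟩ := QuotientGroup.mk_surjective g
    refine ⟨b, b.2, fun x hx => ?_⟩
    obtain ⟨k, hk⟩ := mem_zpowers_iff.1 (hg (QuotientGroup.mk (⟨x, hx⟩ : B)))
    rw [← QuotientGroup.mk_zpow, QuotientGroup.eq, mem_subgroupOf] at hk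
    have hk' : (b : X) ^ (-k) * x ∈ A := by simpa using hk
    have : x = b ^ k * ((b : X) ^ (-k) * x) := by group
    rw [this]
    exact mul_mem (mem_sup_right (zpow_mem (mem_zpowers _) k)) (mem_sup_left hk')
  · rintro ⟨b, hb, hB⟩
    refine ⟨⟨QuotientGroup.mk (⟨b, hb⟩ : B), fun g => ?_⟩⟩
    obtain ⟨⟨x, hx⟩, rfl⟩ := QuotientGroup.mk_surjective g
    have h1 := hB hx
    rw [sup_comm, mem_sup_of_normal_right] at h1
    obtain ⟨y, hy, z, hz, e⟩ := h1
    obtain ⟨k, rfl⟩ := mem_zpowers_iff.1 hy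
    refine ⟨k, ?_⟩
    show (QuotientGroup.mk (⟨b, hb⟩ : B) : ↥B ⧸ A.subgroupOf B) ^ k = QuotientGroup.mk (⟨x, hx⟩ : B)
    rw [← QuotientGroup.mk_zpow, QuotientGroup.eq, mem_subgroupOf]
    have : z = b ^ (-k) * x := by rw [← e]; group
    have h2 : (b ^ k)⁻¹ * x ∈ A := by rw [← zpow_neg, ← this]; exact hz
    simpa using h2

lemma ss_iff : IsSupersoluble X ↔ ReflTransGen CycStep (⊥ : Subgroup X) ⊤ := by
  constructor
  · rintro ⟨k, H, hn, h0, hl, hm, hc⟩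
    have : ∀ i : Fin (k + 1), ReflTransGen CycStep (⊥ : Subgroup X) (H i) := by
      intro i
      induction i using Fin.induction with
      | zero => rw [h0]
      | succ i ih =>
        exact ih.tail ⟨hn _, hn _, hm i, (cyclicFactor_iff _ _ _).1 (hc i)⟩
    rw [← hl]; exact this _
  · intro h
    obtain ⟨k, H, h0, hk, hs⟩ := rtg_seq h
    have hn : ∀ i ≤ k, (H i).Normal := by
      intro i hi
      rcases Nat.lt_or_ge i k with h | h
      · exact (hs i h).1
      · have : i = k := by omega
        rw [this, hk]; infer_instance
    refine ⟨k, fun i => H i, fun i => hn i (by omega), by simpa using h0, by simpa using hk,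
      fun i => ?_, fun i => ?_⟩
    · have := (hs i i.2).2.2.1
      simpa using this
    · rw [cyclicFactor_iff]
      have := (hs i i.2).2.2.2
      simpa using this

lemma cyc_gen (f : X →* Y) (B : Subgroup X) (z : Y) (h : ∀ b ∈ B, f b ∈ zpowers z) :
    ∃ c ∈ B, ∀ x ∈ B, ∃ k : ℤ, f x = f c ^ k := by
  have h1 : B.map f ≤ zpowers z := by
    rintro _ ⟨b, hb, rfl⟩; exact h b hb
  have h2 : IsCyclic (B.map f) :=
    isCyclic_of_injective (inclusion h1) (inclusion_injective h1)
  obtain ⟨⟨g, hg⟩, hgen⟩ := IsCyclic.exists_generator (α := B.map f)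
  obtain ⟨c, hc, rfl⟩ := hg
  refine ⟨c, hc, fun x hx => ?_⟩
  obtain ⟨k, hk⟩ := mem_zpowers_iff.1 (hgen ⟨f x, ⟨x, hx, rfl⟩⟩)
  exact ⟨k, by simpa using (congrArg Subtype.val hk).symm⟩

lemma mk_mem_zpowers {A B : Subgroup X} (hA : A.Normal) {b : X} (h : B ≤ A ⊔ zpowers b) {x : X} (hx : x ∈ B) :
    (QuotientGroup.mk' A) x ∈ zpowers (QuotientGroup.mk' A b) := by
  have h1 := h hx
  rw [sup_comm, mem_sup_of_normal_right] at h1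
  obtain ⟨y, hy, z, hz, rfl⟩ := h1
  obtain ⟨k, rfl⟩ := mem_zpowers_iff.1 hy
  have : (QuotientGroup.mk' A) z = 1 := by simpa using hz
  rw [map_mul, this, mul_one, map_zpow]
  exact zpow_mem (mem_zpowers _) k

lemma CycStep.comap {A B : Subgroup X} (h : CycStep A B) (f : Y →* X) :
    CycStep (A.comap f) (B.comap f) := by
  obtain ⟨hA, hB, hAB, b, hb, hle⟩ := h
  refine ⟨hA.comap f, hB.comap f, comap_mono hAB, ?_⟩
  obtain ⟨c, hc, hgen⟩ := cyc_gen ((QuotientGroup.mk' A).comp f) (B.comap f) (QuotientGroup.mk' A b)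
    (fun x hx => mk_mem_zpowers hA hle hx)
  refine ⟨c, hc, fun x hx => ?_⟩
  obtain ⟨k, hk⟩ := hgen x hx
  have h1 : c ^ (-k) * x ∈ A.comap f := by
    have : (QuotientGroup.mk' A) (f (c ^ (-k) * x)) = 1 := by
      simp only [MonoidHom.comp_apply] at hk
      rw [map_mul, map_mul, hk, map_zpow, map_zpow]; simp
    exact (QuotientGroup.eq_one_iff (f (c ^ (-k) * x))).1 this
  have : x = c ^ k * (c ^ (-k) * x) := by group
  rw [this]
  exact mul_mem (mem_sup_right (zpow_mem (mem_zpowers _) k)) (mem_sup_left h1)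

lemma CycStep.map {A B : Subgroup X} (h : CycStep A B) (f : X →* Y) (hf : Function.Surjective f) :
    CycStep (A.map f) (B.map f) := by
  obtain ⟨hA, hB, hAB, b, hb, hle⟩ := h
  refine ⟨hA.map f hf, hB.map f hf, map_mono hAB, f b, mem_map_of_mem f hb, ?_⟩
  rw [← MonoidHom.map_zpowers, ← Subgroup.map_sup]
  exact map_mono hle

lemma ss_of_injective (f : Y →* X) (hf : Function.Injective f) (h : IsSupersoluble X) :
    IsSupersoluble Y := by
  rw [ss_iff] at h ⊢
  have h1 := ReflTransGen.lift (p := CycStep) (fun A : Subgroup X => A.comap f)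
    (fun A B (h : CycStep A B) => h.comap f) _ _ h
  have e : (⊥ : Subgroup X).comap f = ⊥ := by
    rw [MonoidHom.comap_bot, (MonoidHom.ker_eq_bot_iff f).2 hf]
  simpa [Function.onFun, e] using h1

lemma ss_of_surjective (f : X →* Y) (hf : Function.Surjective f) (h : IsSupersoluble X) :
    IsSupersoluble Y := by
  rw [ss_iff] at h ⊢
  have h1 := ReflTransGen.lift (p := CycStep) (fun A : Subgroup X => A.map f)
    (fun A B (h : CycStep A B) => h.map f hf) _ _ h
  simpa [Function.onFun, map_top_of_surjective f hf] using h1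

lemma ss_mono {S T : Subgroup X} (h : S ≤ T) (hT : IsSupersoluble T) : IsSupersoluble S :=
  ss_of_injective (inclusion h) (inclusion_injective h) hT

lemma ss_map {S : Subgroup X} (f : X →* Y) (hS : IsSupersoluble S) : IsSupersoluble (S.map f) :=
  ss_of_surjective (f.subgroupMap S) (f.subgroupMap_surjective S) hS

lemma ss_of_map_inj {S : Subgroup X} (f : X →* Y) (hf : Function.Injective f)
    (h : IsSupersoluble (S.map f)) : IsSupersoluble S :=
  ss_of_injective (S.equivMapOfInjective f hf).toMonoidHom (S.equivMapOfInjective f hf).injective h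

lemma ss_trivial [Subsingleton X] : IsSupersoluble X := by
  rw [ss_iff, Subsingleton.elim (⊤ : Subgroup X) ⊥]

/-- every interval of normal subgroups contains a cyclic step -/
lemma ss_cf (h : IsSupersoluble X) {A B : Subgroup X} (hA : A.Normal) (hB : B.Normal)
    (hBA : ¬ B ≤ A) : ∃ c ∈ B, c ∉ A ∧ (A ⊔ zpowers c).Normal := by
  rw [ss_iff] at h
  obtain ⟨k, H, h0, hk, hs⟩ := rtg_seq h
  obtain ⟨i, hik, h1, h2⟩ : ∃ i < k, B ⊓ H i ≤ A ∧ ¬ B ⊓ H (i + 1) ≤ A := by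
    by_contra hc
    push Not at hc
    have : ∀ i ≤ k, B ⊓ H i ≤ A := by
      intro i
      induction i with
      | zero => intro _; rw [h0]; simp
      | succ n ih => intro hn; exact hc n (by omega) (ih (by omega))
    apply hBA
    simpa [hk] using this k le_rfl
  obtain ⟨n1, n2, -, b, hb, hle⟩ := hs i hik
  obtain ⟨c, hc, hgen⟩ := cyc_gen (QuotientGroup.mk' (H i)) (B ⊓ H (i + 1)) (QuotientGroup.mk' _ b)
    (fun x hx => mk_mem_zpowers n1 hle hx.2)
  have h3 : B ⊓ H (i + 1) ≤ A ⊔ zpowers c := by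
    intro x hx
    obtain ⟨k, hk⟩ := hgen x hx
    have h1' : c ^ (-k) * x ∈ B ⊓ H i := by
      refine mem_inf.2 ⟨mul_mem (zpow_mem (mem_inf.1 hc).1 _) hx.1, ?_⟩
      have : (QuotientGroup.mk' (H i)) (c ^ (-k) * x) = 1 := by
        rw [map_mul, hk, map_zpow]; simp
      exact (QuotientGroup.eq_one_iff _).1 this
    have : x = c ^ k * (c ^ (-k) * x) := by group
    rw [this]
    exact mul_mem (mem_sup_right (zpow_mem (mem_zpowers _) k)) (mem_sup_left (h1 h1'))
  refine ⟨c, hc.1, fun hcA => h2 ?_, ?_⟩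
  · refine h3.trans (sup_le le_rfl ?_)
    rw [zpowers_le]; exact hcA
  · have e : A ⊔ zpowers c = A ⊔ (B ⊓ H (i + 1)) := by
      apply le_antisymm
      · refine sup_le le_sup_left ?_
        rw [zpowers_le]; exact mem_sup_right hc
      · exact sup_le le_sup_left h3
    rw [e]
    infer_instance

lemma cycStep_of {A : Subgroup X} (hA : A.Normal) {c : X} (hc : (A ⊔ zpowers c).Normal) :
    CycStep A (A ⊔ zpowers c) :=
  ⟨hA, hc, le_sup_left, c, mem_sup_right (mem_zpowers c), le_rfl⟩

/-- a noncyclic chief factor below `V` if `X / V` is supersoluble but `X` is not -/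
lemma exists_bad_chief [Finite X] (h : ¬ IsSupersoluble X) {V : Subgroup X} (hV : V.Normal)
    (hq : IsSupersoluble (X ⧸ V)) :
    ∃ A B : Subgroup X, A.Normal ∧ B.Normal ∧ A ≤ B ∧ ¬ B ≤ A ∧ B ≤ V ∧
      (∀ C : Subgroup X, C.Normal → A ≤ C → C ≤ B → ¬ C ≤ A → C = B) ∧
      ∀ c ∈ B, c ∉ A → ¬ (A ⊔ zpowers c).Normal := by
  have hfin : {A : Subgroup X | A.Normal ∧ A ≤ V ∧ ReflTransGen CycStep ⊥ A}.Finite := Set.toFinite _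
  obtain ⟨A, ⟨hA, hAV, hAr⟩, hAmax⟩ := hfin.exists_maximal ⟨⊥, inferInstance, bot_le, .refl⟩
  have hVA : ¬ V ≤ A := by
    intro hVA
    have e : A = V := le_antisymm hAV hVA
    apply h
    rw [ss_iff] at hq ⊢
    refine (e ▸ hAr : ReflTransGen CycStep ⊥ V).trans ?_
    have h1 := ReflTransGen.lift (p := CycStep) (fun A : Subgroup (X ⧸ V) => A.comap (QuotientGroup.mk' V))
      (fun A B (h : CycStep A B) => h.comap _) _ _ hq
    simpa [Function.onFun, MonoidHom.comap_bot, QuotientGroup.ker_mk'] using h1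
  have hfin2 : {B : Subgroup X | B.Normal ∧ A ≤ B ∧ B ≤ V ∧ ¬ B ≤ A}.Finite := Set.toFinite _
  obtain ⟨B, ⟨hB, hAB, hBV, hBA⟩, hBmin⟩ := hfin2.exists_minimal ⟨V, hV, hAV, le_rfl, hVA⟩
  refine ⟨A, B, hA, hB, hAB, hBA, hBV, ?_, ?_⟩
  · intro C hC h1 h2 h3
    exact le_antisymm h2 (hBmin ⟨hC, h1, h2.trans hBV, h3⟩ h2)
  · intro c hcB hcA hn
    have hle : A ⊔ zpowers c ≤ V := sup_le hAV (by rw [zpowers_le]; exact hBV hcB)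
    have := hAmax (y := A ⊔ zpowers c) ⟨hn, hle, hAr.tail (cycStep_of hA hn)⟩ le_sup_left
    exact hcA (this (mem_sup_right (mem_zpowers c)))

end SS
end NSG

namespace NSG
open Subgroup Relation

section S3

lemma exists_normal_prime {X : Type u} [Group X] [Finite X] (h : IsSupersoluble X) [Nontrivial X] :
    ∃ (q : ℕ) (c : X), q.Prime ∧ orderOf c = q ∧ (zpowers c).Normal := by
  obtain ⟨c, -, hc1, hn⟩ := ss_cf h (A := ⊥) (B := ⊤) inferInstance inferInstance
    (by simp)
  rw [bot_sup_eq] at hn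
  have hc : orderOf c ≠ 1 := by rw [Ne, orderOf_eq_one_iff]; simpa using hc1
  refine ⟨(orderOf c).minFac, c ^ (orderOf c / (orderOf c).minFac), Nat.minFac_prime hc,
    orderOf_pow_orderOf_div (orderOf_pos c).ne' (Nat.minFac_dvd _), ?_⟩
  constructor
  intro n hn' g
  obtain ⟨k, rfl⟩ := mem_zpowers_iff.1 hn'
  obtain ⟨j, hj⟩ := mem_zpowers_iff.1 (hn.conj_mem c (mem_zpowers c) g)
  rw [← conj_zpow, ← conj_pow, ← hj]
  have : (c ^ j) ^ (orderOf c / (orderOf c).minFac) = (c ^ (orderOf c / (orderOf c).minFac)) ^ j := by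
    rw [← zpow_natCast, ← zpow_natCast, ← zpow_mul, ← zpow_mul, mul_comm]
  rw [this]
  exact zpow_mem (zpow_mem (mem_zpowers _) _) _

theorem ss_pel_aux (p : ℕ) [hp : Fact p.Prime] : ∀ n : ℕ, ∀ (X : Type u) [Group X] [Finite X],
    Nat.card X = n → IsSupersoluble X → (∀ q, q.Prime → q ∣ Nat.card X → q ≤ p) →
    ∀ w : X, PEl p w → w ∈ Op p X := by
  intro n
  induction n using Nat.strong_induction_on with
  | _ n ih =>
  intro X _ _ hn hss hle w pw
  rcases subsingleton_or_nontrivial X with hs | hs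
  · rw [Subsingleton.elim w 1]; exact one_mem _
  obtain ⟨q, c, hq, hcq, hN⟩ := exists_normal_prime hss
  have hcardN : Nat.card (zpowers c) = q := by rw [Nat.card_zpowers, hcq]
  have hqX : q ∣ Nat.card X := hcq ▸ orderOf_dvd_natCard c
  have hcard : Nat.card X = Nat.card (X ⧸ zpowers c) * q := by
    rw [Subgroup.card_eq_card_quotient_mul_card_subgroup (zpowers c), hcardN]
  have hlt : Nat.card (X ⧸ zpowers c) < n := by
    rw [← hn, hcard]
    have h1 := hq.two_le
    have h2 : 0 < Nat.card (X ⧸ zpowers c) := Nat.card_pos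
    nlinarith
  have hIH := ih _ hlt (X ⧸ zpowers c) rfl
    (ss_of_surjective (QuotientGroup.mk' _) (QuotientGroup.mk'_surjective _) hss)
    (fun r hr hrd => hle r hr (hrd.trans (hcard ▸ Dvd.intro _ rfl)))
  rw [Op, mem_iInf]
  intro P
  have h1 := hIH (QuotientGroup.mk' _ w) (pw.map _)
  rw [Op, mem_iInf] at h1
  have h2 := h1 (P.mapSurjective (QuotientGroup.mk'_surjective (zpowers c)))
  rw [Sylow.coe_mapSurjective] at h2
  obtain ⟨s, hs, hse⟩ := h2
  have hsn : s⁻¹ * w ∈ zpowers c := QuotientGroup.eq.1 hse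
  have hsP : s ∈ (P : Subgroup X) := hs
  have ps : PEl p s := PEl.of_mem P.isPGroup' hsP
  suffices h : s⁻¹ * w ∈ (P : Subgroup X) by
    have := mul_mem hsP h
    simpa using this
  rcases (hle q hq hqX).lt_or_eq with hqp | hqp
  · -- q < p
    have hcen : ∀ n ∈ zpowers c, s * n * s⁻¹ = n := by
      have hord : orderOf (MulAut.conjNormal (H := zpowers c) s) = 1 := by
        have e1 : orderOf (MulAut.conjNormal (H := zpowers c) s) ∣ q - 1 := by
          have := orderOf_dvd_natCard (MulAut.conjNormal (H := zpowers c) s)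
          rwa [IsCyclic.card_mulAut, hcardN, Nat.totient_prime hq] at this
        obtain ⟨k, hk⟩ := ps
        have e2 : orderOf (MulAut.conjNormal (H := zpowers c) s) ∣ p ^ k := by
          apply orderOf_dvd_of_pow_eq_one
          rw [← map_pow, hk, map_one]
        have e3 : Nat.Coprime (p ^ k) (q - 1) := by
          apply Nat.Coprime.pow_left
          rw [hp.out.coprime_iff_not_dvd]
          intro h
          have := Nat.le_of_dvd (by have := hq.two_le; omega) h
          omega
        exact Nat.eq_one_of_dvd_coprimes e3 e2 e1
      rw [orderOf_eq_one_iff] at hord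
      intro n hn
      have := congrArg (fun f => ((f ⟨n, hn⟩ : zpowers c) : X)) hord
      simpa using this
    have hcomm : Commute s (s⁻¹ * w) := by
      have := hcen _ hsn
      have h3 := congrArg (fun t => t * s) this
      show s * (s⁻¹ * w) = s⁻¹ * w * s
      simpa using h3
    have pn : PEl p (s⁻¹ * w) := by
      have hc2 : Commute s⁻¹ w := by
        have h3 : s * (s⁻¹ * w) = s⁻¹ * w * s := hcomm
        have h4 := congrArg (fun t => t * s⁻¹) h3
        show s⁻¹ * w = w * s⁻¹
        simpa [mul_assoc] using h4.symm
      exact ps.inv.mul_comm pw hc2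
    have : s⁻¹ * w = 1 := by
      obtain ⟨k, hk⟩ := pn
      have e1 : orderOf (s⁻¹ * w) ∣ p ^ k := orderOf_dvd_of_pow_eq_one hk
      have e2 : orderOf (s⁻¹ * w) ∣ q := by
        rw [← hcardN]
        have := orderOf_dvd_natCard (⟨s⁻¹ * w, hsn⟩ : zpowers c)
        simpa using this
      have e3 : Nat.Coprime (p ^ k) q := by
        apply Nat.Coprime.pow_left
        exact (Nat.coprime_primes hp.out hq).2 hqp.ne'
      exact orderOf_eq_one_iff.1 (Nat.eq_one_of_dvd_coprimes e3 e1 e2)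
    rw [this]; exact one_mem _
  · have hNp : IsPGroup p (zpowers c) := PEl.zpowers ⟨1, by rw [pow_one, ← hqp, ← hcq, pow_orderOf_eq_one]⟩
    exact hNp.le_sylow_of_normal P hsn

theorem ss_pel {p : ℕ} [Fact p.Prime] {X : Type u} [Group X] [Finite X] (h : IsSupersoluble X)
    (hle : ∀ q, q.Prime → q ∣ Nat.card X → q ≤ p) {w : X} (hw : PEl p w) : w ∈ Op p X :=
  ss_pel_aux p _ X rfl h hle w hw

/-- relative version: p-elements of a supersoluble subgroup lie in `OpIn`. -/
theorem ss_pel_in {p : ℕ} [Fact p.Prime] {X : Type u} [Group X] [Finite X] {S : Subgroup X}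
    (h : IsSupersoluble S) (hle : ∀ q, q.Prime → q ∣ Nat.card X → q ≤ p) {w : X} (hw : PEl p w)
    (hwS : w ∈ S) : w ∈ OpIn p S := by
  have := ss_pel (p := p) h (fun q hq hd => hle q hq (hd.trans (card_subgroup_dvd_card S)))
    (w := ⟨w, hwS⟩) (PEl.of_map S.subtype (subtype_injective S) hw)
  exact ⟨_, this, rfl⟩

theorem padj_not_ss {p : ℕ} [Fact p.Prime] {X : Type u} [Group X] [Finite X]
    (hle : ∀ q, q.Prime → q ∣ Nat.card X → q ≤ p) {a b : X} (h : padj p a b) :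
    ¬ IsSupersoluble (closure {a, b}) := by
  intro hss
  apply h.2.2
  have h1 : closure {a, b} ≤ OpIn p (closure {a, b}) := by
    rw [closure_le]
    rintro x (rfl | rfl)
    · exact ss_pel_in hss hle h.1 (subset_closure (by simp))
    · exact ss_pel_in hss hle h.2.1 (subset_closure (by simp))
  exact OpIn_pgroup.to_le h1

end S3
end NSG

namespace NSG
open Subgroup Relation

section U
variable {p : ℕ} [hp : Fact p.Prime] {Y : Type u} [Group Y] [Finite Y]

structure Chief (p : ℕ) (V U : Subgroup Y) : Prop where
  hV : V.Normal
  hVp : IsPGroup p V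
  hUV : U ≤ V
  hU : U.Normal
  hne : U ≠ ⊥
  hmin : ∀ C : Subgroup Y, C.Normal → C ≤ U → C ≠ ⊥ → C = U
  hcyc : ∀ c ∈ U, c ≠ 1 → ¬ (zpowers c).Normal

variable {V U : Subgroup Y}

lemma Chief.cent (h : Chief p V U) {W : Subgroup Y} (hW : W.Normal) (hWp : IsPGroup p W) {w : Y}
    (hw : w ∈ W) {u : Y} (hu : u ∈ U) : w * u = u * w := by
  have hUn := h.hU
  let _ : MulAction W U := MulAction.compHom U ((MulAut.conjNormal (H := U)).comp W.subtype)
  have hact : ∀ (a : W) (b : U), ((a • b : U) : Y) = a * b * (a : Y)⁻¹ := by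
    intro a b
    exact MulAut.conjNormal_apply (a : Y) b
  have hUp : IsPGroup p U := h.hVp.to_le h.hUV
  have hpd : p ∣ Nat.card U := by
    have : Nontrivial U := (nontrivial_iff_ne_bot U).2 h.hne
    obtain ⟨n, hn, e⟩ := (IsPGroup.nontrivial_iff_card hUp).1 this
    rw [e]; exact dvd_pow_self p hn.ne'
  obtain ⟨b, hb, hb1⟩ := hWp.exists_fixed_point_of_prime_dvd_card_of_fixed_point (α := U) hpd
    (a := 1) (fun a => Subtype.ext (by rw [hact]; simp))
  have hcn : (centralizer (W : Set Y)).Normal := inferInstance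
  have hC := h.hmin (U ⊓ centralizer (W : Set Y)) inferInstance inf_le_left (by
    intro hbot
    have : (b : Y) ∈ U ⊓ centralizer (W : Set Y) := by
      refine mem_inf.2 ⟨b.2, mem_centralizer_iff.2 fun a ha => ?_⟩
      have := congrArg Subtype.val (hb ⟨a, ha⟩)
      rw [hact] at this
      simpa using mul_inv_eq_iff_eq_mul.1 this
    rw [hbot, mem_bot] at this
    exact hb1 (Subtype.ext this.symm))
  have : u ∈ U ⊓ centralizer (W : Set Y) := by rw [hC]; exact hu
  exact mem_centralizer_iff.1 (mem_inf.1 this).2 w hw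

lemma Chief.centV (h : Chief p V U) {w : Y} (hw : w ∈ V) {u : Y} (hu : u ∈ U) : w * u = u * w :=
  h.cent h.hV h.hVp hw hu

/-- a normal-cyclic test: normalised by `S` with `S ⊔ V = ⊤`. -/
lemma Chief.normal_of (h : Chief p V U) {S C : Subgroup Y} (hS : S ⊔ V = ⊤) (hC : C ≤ U)
    (hn : ∀ s ∈ S, ∀ c ∈ C, s * c * s⁻¹ ∈ C) : C.Normal := by
  constructor
  intro c hc g
  have hg : g ∈ S ⊔ V := by rw [hS]; trivial
  have := h.hV
  rw [mem_sup_of_normal_right] at hg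
  obtain ⟨s, hs, v, hv, rfl⟩ := hg
  have e : s * v * c * (s * v)⁻¹ = s * c * s⁻¹ := by
    have := h.centV hv (hC hc)
    rw [mul_assoc s v c, this]; group
  rw [e]; exact hn s hs c hc

lemma Chief.inf_bot (h : Chief p V U) {S : Subgroup Y} (hS : S ⊔ V = ⊤) (hss : IsSupersoluble S) :
    ∀ u ∈ U, u ∈ S → u = 1 := by
  by_contra hcon
  push Not at hcon
  obtain ⟨u, huU, huS, hu1⟩ := hcon
  have hUn := h.hU
  obtain ⟨c, hc, hc1, hn⟩ := ss_cf hss (A := ⊥) (B := U.subgroupOf S) inferInstance inferInstance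
    (fun hle => hu1 (by
      have := hle (show (⟨u, huS⟩ : S) ∈ U.subgroupOf S from huU)
      simpa using this))
  rw [bot_sup_eq] at hn
  refine h.hcyc c hc (by simpa using hc1) (h.normal_of hS ?_ ?_)
  · rw [zpowers_le]; exact hc
  · intro s hs y hy
    obtain ⟨k, rfl⟩ := mem_zpowers_iff.1 hy
    obtain ⟨j, hj⟩ := mem_zpowers_iff.1 (hn.conj_mem (c ^ k) (zpow_mem (mem_zpowers c) k) ⟨s, hs⟩)
    refine mem_zpowers_iff.2 ⟨j, ?_⟩
    simpa using congrArg Subtype.val hj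

theorem lemmaU (h : Chief p V U) (hle : ∀ q, q.Prime → q ∣ Nat.card Y → q ≤ p)
    {x f u : Y} (hgen : closure {x, f} ⊔ V = ⊤) (h1 : IsSupersoluble (closure {x, f}))
    (hu : u ∈ U) (h2 : IsSupersoluble (closure {x, f * u})) :
    ∃ t ∈ U, x * t = t * x ∧ f * u = t⁻¹ * f * t := by
  have hUn := h.hU
  have hVn := h.hV
  set S1 := closure {x, f} with hS1
  set S2 := closure {x, f * u} with hS2
  have hx1 : x ∈ S1 := subset_closure (by simp)
  have hf1 : f ∈ S1 := subset_closure (by simp)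
  have hx2 : x ∈ S2 := subset_closure (by simp)
  have hf2 : f * u ∈ S2 := subset_closure (by simp)
  have hsub : S1 ≤ S2 ⊔ U := by
    rw [hS1, closure_le]
    rintro y (rfl | rfl)
    · exact mem_sup_left hx2
    · have : y = y * u * u⁻¹ := by group
      rw [this]
      exact mul_mem (mem_sup_left hf2) (mem_sup_right (inv_mem hu))
  have hgen2 : S2 ⊔ V = ⊤ := by
    rw [eq_top_iff, ← hgen]
    exact sup_le (hsub.trans (sup_le le_sup_left (h.hUV.trans le_sup_right))) le_sup_right
  have hb1 := h.inf_bot hgen h1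
  have hb2 := h.inf_bot hgen2 h2
  have hab : ∀ a ∈ U, ∀ b ∈ U, a * b = b * a := fun a ha b hb => h.centV (h.hUV ha) hb
  let _ : CommGroup U := { (inferInstance : Group U) with
    mul_comm := fun a b => Subtype.ext (hab a a.2 b b.2) }
  have hex : ∀ s : S1, ∃ v : U, (s : Y) * v ∈ S2 := by
    intro s
    have := hsub s.2
    rw [mem_sup_of_normal_right] at this
    obtain ⟨a, ha, b, hb, e⟩ := this
    refine ⟨⟨b⁻¹, inv_mem hb⟩, ?_⟩
    rw [← e]; simpa using ha
  choose φ hφ using hex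
  have huniq : ∀ (s : S1) (v : U), (s : Y) * v ∈ S2 → φ s = v := by
    intro s v hv
    have : ((s : Y) * φ s)⁻¹ * (s * v) ∈ S2 := mul_mem (inv_mem (hφ s)) hv
    have e : ((s : Y) * φ s)⁻¹ * (s * v) = ((φ s)⁻¹ * v : U) := by
      push_cast; group
    rw [e] at this
    have := hb2 _ (SetLike.coe_mem _) this
    have : (φ s)⁻¹ * v = 1 := Subtype.ext this
    exact inv_mul_eq_one.1 this
  have hcoc : ∀ s t : S1, φ (s * t) = MulAut.conjNormal (H := U) (t : Y)⁻¹ (φ s) * φ t := by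
    intro s t
    apply huniq
    have := mul_mem (hφ s) (hφ t)
    convert this using 1
    push_cast
    rw [MulAut.conjNormal_apply]; group
  -- R
  set R := Op p S1 with hR
  have hRn : R.Normal := Op_normal
  have hcardS : ∀ q, q.Prime → q ∣ Nat.card S1 → q ≤ p := fun q hq hd =>
    hle q hq (hd.trans (card_subgroup_dvd_card S1))
  have hRmem : ∀ w : S1, PEl p w → w ∈ R := fun w hw => ss_pel h1 hcardS hw
  have hRU : ∀ r ∈ R, ∀ v ∈ U, (r : Y) * v = v * r := by
    intro r hr v hv
    have hWp : IsPGroup p ↥(R.map S1.subtype ⊔ V) :=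
      sup_pgroup (Op_pgroup.map _) h.hVp fun s _ w hw => hVn.conj_mem w hw s
    refine h.cent (W := R.map S1.subtype ⊔ V) ?_ hWp (mem_sup_left ⟨r, hr, rfl⟩) hv
    rw [← normalizer_eq_top_iff, eq_top_iff, ← hgen]
    refine sup_le ?_ (le_sup_right.trans le_normalizer)
    have key : ∀ s ∈ S1, ∀ n ∈ R.map S1.subtype ⊔ V, s * n * s⁻¹ ∈ R.map S1.subtype ⊔ V := by
      intro s hs n hn
      rw [mem_sup_of_normal_right] at hn ⊢
      obtain ⟨_, ⟨r, hr, rfl⟩, v, hv, rfl⟩ := hn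
      refine ⟨s * r * s⁻¹, ⟨⟨s, hs⟩ * r * ⟨s, hs⟩⁻¹, hRn.conj_mem _ hr _, rfl⟩, s * v * s⁻¹,
        hVn.conj_mem _ hv _, by simp [mul_assoc]⟩
    intro s hs
    rw [mem_normalizer_iff]
    refine fun n => ⟨key s hs n, fun hn => ?_⟩
    have := key s⁻¹ (inv_mem hs) _ hn
    simpa [mul_assoc] using this
  have hRc : ∀ r ∈ R, ∀ v : U, MulAut.conjNormal (H := U) (r : Y)⁻¹ v = v := by
    intro r hr v
    apply Subtype.ext
    rw [MulAut.conjNormal_apply, inv_inv, mul_assoc, ← hRU r hr v v.2]; group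
  have hφR : ∀ r ∈ R, φ r = 1 := by
    by_contra hcon
    push Not at hcon
    obtain ⟨r0, hr0, hr01⟩ := hcon
    have h1φ : φ 1 = 1 := huniq 1 1 (by simp)
    have hhom : ∀ a b, b ∈ R → φ (a * b) = φ a * φ b := by
      intro a b hb; rw [hcoc, hRc b hb]
    have hequi : ∀ s r, r ∈ R → φ (s * r * s⁻¹) = MulAut.conjNormal (H := U) (s : Y) (φ r) := by
      intro s r hr
      apply huniq
      have := mul_mem (mul_mem (hφ s) (hφ r)) (inv_mem (hφ s))
      convert this using 1
      rw [MulAut.conjNormal_apply]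
      push_cast
      have e1 := hRU r hr (φ s) (φ s).2
      have e2 := hab (φ s) (φ s).2 (φ r) (φ r).2
      calc (s : Y) * r * (s : Y)⁻¹ * (s * φ r * (s : Y)⁻¹) = s * (r * φ r) * (s : Y)⁻¹ := by group
        _ = s * (r * φ s * φ r * (φ s : Y)⁻¹) * (s : Y)⁻¹ := by
            rw [mul_assoc (r : Y) (φ s : Y), e2]; group
        _ = _ := by rw [e1]; group
    let A : Subgroup S1 :=
      { carrier := {r | r ∈ R ∧ φ r = 1}
        one_mem' := ⟨one_mem _, h1φ⟩
        mul_mem' := fun {a b} ha hb => ⟨mul_mem ha.1 hb.1, by rw [hhom a b hb.1, ha.2, hb.2, one_mul]⟩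
        inv_mem' := fun {a} ha => ⟨inv_mem ha.1, by
          have := hhom a a⁻¹ (inv_mem ha.1)
          rw [mul_inv_cancel, h1φ, ha.2, one_mul] at this
          exact this.symm⟩ }
    have hAn : A.Normal := by
      constructor
      rintro n ⟨hn, hn1⟩ g
      exact ⟨hRn.conj_mem n hn g, by rw [hequi g n hn, hn1, map_one]⟩
    obtain ⟨c, hc, hcA, hn⟩ := ss_cf h1 hAn hRn (fun hle => hr01 (hle hr0).2)
    have hpow : ∀ k : ℕ, φ (c ^ k) = φ c ^ k := by
      intro k
      induction k with
      | zero => simpa using h1φ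
      | succ k ih => rw [pow_succ, hhom _ _ hc, ih, pow_succ]
    refine h.hcyc (φ c) (φ c).2 (fun h0 => hcA ⟨hc, Subtype.ext h0⟩) (h.normal_of hgen ?_ ?_)
    · rw [zpowers_le]; exact (φ c).2
    · intro s hs y hy
      obtain ⟨k, rfl⟩ := mem_zpowers_iff.1 hy
      have hm : (⟨s, hs⟩ : S1) * c * ⟨s, hs⟩⁻¹ ∈ A ⊔ zpowers c :=
        hn.conj_mem c (mem_sup_right (mem_zpowers c)) _
      rw [mem_sup_of_normal_left] at hm
      obtain ⟨a, ha, d, hd, e⟩ := hm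
      obtain ⟨j, rfl⟩ := (mem_powers_iff_mem_zpowers (x := c) (y := d)).2 hd
      change a * c ^ j = _ at e
      have := hequi ⟨s, hs⟩ c hc
      rw [← e, hhom _ _ (pow_mem hc _), ha.2, one_mul, hpow] at this
      have e2 := congrArg Subtype.val this
      rw [MulAut.conjNormal_apply] at e2
      rw [← conj_zpow]
      refine zpow_mem ?_ k
      simp only at e2
      rw [← e2]
      exact pow_mem (mem_zpowers _) _
  -- averaging
  have hφc : ∀ s r, r ∈ R → φ (s * r) = φ s := by
    intro s r hr; rw [hcoc, hRc r hr, hφR r hr, mul_one]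
  let ψ : S1 ⧸ R → U := fun q => φ q.out
  have hψ : ∀ s : S1, ψ (s : S1 ⧸ R) = φ s := by
    intro s
    have : s⁻¹ * (s : S1 ⧸ R).out ∈ R := QuotientGroup.eq.1 (by simp)
    have h3 := hφc s _ this
    rw [← h3]; simp [ψ]
  have : Fintype (S1 ⧸ R) := Fintype.ofFinite _
  set w : U := ∏ q, ψ q with hw
  set k := Nat.card (S1 ⧸ R) with hk
  have hws : ∀ s : S1, w = MulAut.conjNormal (H := U) (s : Y)⁻¹ w * φ s ^ k := by
    intro s
    have e1 : w = ∏ q : S1 ⧸ R, ψ (q * s) :=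
      (Fintype.prod_equiv (Equiv.mulRight (s : S1 ⧸ R)) _ _ (fun q => rfl)).symm
    have e2 : ∀ q : S1 ⧸ R, ψ (q * s) = MulAut.conjNormal (H := U) (s : Y)⁻¹ (ψ q) * φ s := by
      intro q
      obtain ⟨a, rfl⟩ := QuotientGroup.mk_surjective q
      rw [← QuotientGroup.mk_mul, hψ, hψ, hcoc]
    refine e1.trans ?_
    rw [Finset.prod_congr rfl (fun q _ => e2 q), Finset.prod_mul_distrib, Finset.prod_const,
      ← map_prod, ← hw, Finset.card_univ, hk, Nat.card_eq_fintype_card]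
  have hcop : Nat.Coprime k (Nat.card U) := by
    have hUp : IsPGroup p U := h.hVp.to_le h.hUV
    obtain ⟨n, hn⟩ := IsPGroup.iff_card.1 hUp
    rw [hn]
    apply Nat.Coprime.pow_right
    rw [Nat.coprime_comm, hp.out.coprime_iff_not_dvd]
    intro hd
    obtain ⟨q, hq⟩ := exists_prime_orderOf_dvd_card' (G := S1 ⧸ R) p hd
    obtain ⟨a, rfl⟩ := QuotientGroup.mk_surjective q
    have ha : PEl p a := PEl.of_quot Op_pgroup ⟨1, by
      have := pow_orderOf_eq_one (a : S1 ⧸ R)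
      rw [hq] at this
      rwa [pow_one]⟩
    have : (a : S1 ⧸ R) = 1 := (QuotientGroup.eq_one_iff a).2 (hRmem a ha)
    rw [this, orderOf_one] at hq
    exact hp.out.one_lt.ne hq
  obtain ⟨j, hj⟩ : ∃ j : ℕ, ∀ v : U, v ^ (k * j) = v := by
    rcases Nat.lt_or_ge 1 (Nat.card U) with h1 | h1
    · obtain ⟨j, -, hj⟩ := Nat.exists_mul_mod_eq_one_of_coprime hcop h1
      refine ⟨j, fun v => ?_⟩
      rw [← pow_mod_natCard, hj, pow_one]
    · refine ⟨0, fun v => ?_⟩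
      have : Subsingleton U := Finite.card_le_one_iff_subsingleton.1 h1
      exact Subsingleton.elim _ _
  have ht : ∀ s : S1, (s : Y) * φ s = ((w ^ j : U) : Y)⁻¹ * s * (w ^ j : U) := by
    intro s
    have e : w ^ j = MulAut.conjNormal (H := U) (s : Y)⁻¹ (w ^ j) * φ s := by
      conv_lhs => rw [hws s]
      rw [mul_pow, ← pow_mul, hj, map_pow]
    have e' := congrArg Subtype.val e
    rw [Subgroup.coe_mul, MulAut.conjNormal_apply] at e'
    generalize ((w ^ j : U) : Y) = t at *
    have : (φ s : Y) = ((s : Y)⁻¹ * t * (s : Y)⁻¹⁻¹)⁻¹ * t := by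
      rw [eq_inv_mul_iff_mul_eq]; exact e'.symm
    rw [this]; group
  refine ⟨(w ^ j : U), SetLike.coe_mem _, ?_, ?_⟩
  · have := ht ⟨x, hx1⟩
    rw [huniq ⟨x, hx1⟩ 1 (by simpa using hx2)] at this
    simp only [OneMemClass.coe_one, mul_one] at this
    rw [mul_assoc, eq_inv_mul_iff_mul_eq] at this
    exact this.symm
  · have := ht ⟨f, hf1⟩
    rw [huniq ⟨f, hf1⟩ ⟨u, hu⟩ hf2] at this
    exact this

end U
end NSG

namespace NSG
open Subgroup Relation
open scoped commutatorElement

section Eig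

lemma exists_eig_aux (p : ℕ) [hp : Fact p.Prime] {M : Type u} [AddCommGroup M] [Module (ZMod p) M]
    [Finite M] [Nontrivial M] (L : Module.End (ZMod p) M) (hL : L ^ p = L) :
    ∃ (a : ℕ) (m : M), m ≠ 0 ∧ L m = a • m := by
  have hz : Polynomial.aeval L (Polynomial.X ^ p - Polynomial.X : Polynomial (ZMod p)) = 0 := by
    simp [hL]
  have hd := minpoly.dvd (ZMod p) L hz
  have hne : (Polynomial.X ^ p - Polynomial.X : Polynomial (ZMod p)) ≠ 0 :=
    FiniteField.X_pow_card_sub_X_ne_zero _ hp.out.one_lt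
  have hsp : (Polynomial.X ^ p - Polynomial.X : Polynomial (ZMod p)).Splits := by
    have := FiniteField.splits_X_pow_card_sub_X (K := ZMod p) p
    simpa using this
  have hs2 := hsp.of_dvd hne hd
  have hfin : Module.Finite (ZMod p) M := Module.Finite.of_finite
  have hint : IsIntegral (ZMod p) L := Algebra.IsIntegral.isIntegral L
  obtain ⟨a, ha⟩ := hs2.exists_eval_eq_zero (minpoly.degree_pos hint).ne'
  have hev := Module.End.hasEigenvalue_of_isRoot (f := L) ha
  obtain ⟨m, hm⟩ := hev.exists_hasEigenvector
  refine ⟨a.val, m, hm.2, ?_⟩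
  have h1 : L m = a • m := hm.apply_eq_smul
  rw [h1]
  conv_lhs => rw [← ZMod.natCast_zmod_val a]
  rw [Nat.cast_smul_eq_nsmul]

lemma exists_eig (p : ℕ) [hp : Fact p.Prime] {M : Type u} [AddCommGroup M] [Finite M] [Nontrivial M]
    (hM : ∀ m : M, p • m = 0) (T : M →+ M) (hT : ∀ m, T^[p - 1] m = m) :
    ∃ (a : ℕ) (m : M), m ≠ 0 ∧ T m = a • m := by
  let _ : Module (ZMod p) M := AddCommGroup.zmodModule hM
  refine exists_eig_aux p (T.toZModLinearMap p) ?_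
  apply LinearMap.ext
  intro m
  rw [Module.End.pow_apply]
  have e : p = (p - 1) + 1 := by have := hp.out.two_le; omega
  change T^[p] m = T m
  conv_lhs => rw [e]
  rw [Function.iterate_succ_apply, hT]

variable {p : ℕ} [hp : Fact p.Prime] {Y : Type u} [Group Y] [Finite Y] {V U : Subgroup Y}

lemma Chief.comm (h : Chief p V U) : ∀ a ∈ U, ∀ b ∈ U, a * b = b * a :=
  fun _ ha _ hb => h.centV (h.hUV ha) hb

lemma Chief.exp (h : Chief p V U) : ∀ u ∈ U, u ^ p = 1 := by
  have hUn := h.hU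
  let C : Subgroup Y :=
    { carrier := {u | u ∈ U ∧ u ^ p = 1}
      one_mem' := ⟨one_mem _, one_pow _⟩
      mul_mem' := fun {a b} ha hb => ⟨mul_mem ha.1 hb.1, by
        have : Commute a b := h.comm a ha.1 b hb.1
        rw [this.mul_pow, ha.2, hb.2, one_mul]⟩
      inv_mem' := fun {a} ha => ⟨inv_mem ha.1, by rw [inv_pow, ha.2, inv_one]⟩ }
  have hC : C = U := by
    apply h.hmin
    · constructor
      rintro n ⟨h1, h2⟩ g
      exact ⟨hUn.conj_mem n h1 g, by rw [conj_pow, h2]; group⟩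
    · exact fun x hx => hx.1
    · intro hbot
      have hUp : IsPGroup p U := h.hVp.to_le h.hUV
      have hpd : p ∣ Nat.card U := by
        have : Nontrivial U := (nontrivial_iff_ne_bot U).2 h.hne
        obtain ⟨n, hn, e⟩ := (IsPGroup.nontrivial_iff_card hUp).1 this
        rw [e]; exact dvd_pow_self p hn.ne'
      obtain ⟨v, hv⟩ := exists_prime_orderOf_dvd_card' (G := U) p hpd
      have hv1 : (v : Y) ^ p = 1 := by
        have := pow_orderOf_eq_one v
        rw [hv] at this
        simpa using congrArg Subtype.val this
      have : (v : Y) ∈ C := ⟨v.2, hv1⟩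
      rw [hbot, mem_bot] at this
      have : v = 1 := Subtype.ext this
      rw [this, orderOf_one] at hv
      exact hp.out.one_lt.ne hv
  intro u hu
  rw [← hC] at hu
  exact hu.2

lemma nz_closure {C : Subgroup Y} {S : Set Y} (h : ∀ s ∈ S, ∀ c ∈ C, s * c * s⁻¹ ∈ C) :
    ∀ s ∈ closure S, ∀ c ∈ C, s * c * s⁻¹ ∈ C := by
  have : closure S ≤ normalizer (C : Set Y) := by
    rw [closure_le]
    intro s hs
    exact mem_normalizer_fintype (S := (C : Set Y)) fun n hn => h s hs n hn
  intro s hs c hc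
  exact (mem_normalizer_iff.1 (this hs) c).1 hc

lemma Chief.scalar (h : Chief p V U) {x f : Y} (hgen : closure {x, f} ⊔ V = ⊤)
    (hc : ∀ u ∈ U, ⁅x, f⁆ * u = u * ⁅x, f⁆) (hx : ∀ u ∈ U, x ^ (p - 1) * u = u * x ^ (p - 1)) :
    ∃ a : ℕ, ∀ u ∈ U, x * u * x⁻¹ = u ^ a := by
  have hUn := h.hU
  let _ : CommGroup U := { (inferInstance : Group U) with
    mul_comm := fun a b => Subtype.ext (h.comm a a.2 b b.2) }
  have : Nontrivial U := (nontrivial_iff_ne_bot U).2 h.hne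
  have : Nontrivial (Additive U) := inferInstanceAs (Nontrivial U)
  have : Finite (Additive U) := inferInstanceAs (Finite U)
  obtain ⟨a, m, hm, hT⟩ := exists_eig p (M := Additive U)
    (fun m => by
      have : (Additive.toMul m) ^ p = 1 := Subtype.ext (by simpa using h.exp _ (Additive.toMul m).2)
      exact this)
    (MonoidHom.toAdditive (MulAut.conjNormal (H := U) x).toMonoidHom) (by
      intro m
      have key : ∀ n : ℕ, ∀ v : U, ((MulAut.conjNormal (H := U) x)^[n] v : U) =
          MulAut.conjNormal (H := U) (x ^ n) v := by
        intro n
        induction n with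
        | zero => intro v; simp
        | succ n ih => intro v; rw [Function.iterate_succ_apply, ih, pow_succ, map_mul]; rfl
      have e := key (p - 1) (Additive.toMul m)
      have e2 : MulAut.conjNormal (H := U) (x ^ (p - 1)) (Additive.toMul m) = Additive.toMul m := by
        apply Subtype.ext
        rw [MulAut.conjNormal_apply, hx _ (Additive.toMul m).2]; group
      exact e.trans e2)
  have hT' : x * (Additive.toMul m : U) * x⁻¹ = ((Additive.toMul m : U) : Y) ^ a := by
    have := congrArg (fun z => ((Additive.toMul z : U) : Y)) hT
    simpa using this
  let E : Subgroup Y :=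
    { carrier := {u | u ∈ U ∧ x * u * x⁻¹ = u ^ a}
      one_mem' := ⟨one_mem _, by simp⟩
      mul_mem' := fun {b c} hb hc => ⟨mul_mem hb.1 hc.1, by
        have : Commute b c := h.comm b hb.1 c hc.1
        rw [this.mul_pow, ← hb.2, ← hc.2]; group⟩
      inv_mem' := fun {b} hb => ⟨inv_mem hb.1, by rw [inv_pow, ← hb.2]; group⟩ }
  have hE : E = U := by
    apply h.hmin
    · refine h.normal_of hgen (fun u hu => hu.1) (nz_closure ?_)
      rintro s (rfl | rfl) c ⟨hcU, hce⟩
      · refine ⟨hUn.conj_mem c hcU s, ?_⟩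
        rw [conj_pow, ← hce]
      · refine ⟨hUn.conj_mem c hcU s, ?_⟩
        have h1 := hc _ (hUn.conj_mem _ (hUn.conj_mem c hcU x) s)
        rw [conj_pow, ← hce]
        calc x * (s * c * s⁻¹) * x⁻¹ = ⁅x, s⁆ * (s * (x * c * x⁻¹) * s⁻¹) * ⁅x, s⁆⁻¹ := by
              simp [commutatorElement_def, mul_assoc]
          _ = _ := by rw [h1, mul_inv_cancel_right]
    · exact fun u hu => hu.1
    · intro hbot
      have : ((Additive.toMul m : U) : Y) ∈ E := ⟨SetLike.coe_mem _, hT'⟩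
      rw [hbot, mem_bot] at this
      exact hm (Subtype.ext this)
  refine ⟨a, fun u hu => ?_⟩
  rw [← hE] at hu
  exact hu.2

lemma Chief.eig (h : Chief p V U) {x f : Y} (hgen : closure {x, f} ⊔ V = ⊤)
    (hc : ∀ u ∈ U, ⁅x, f⁆ * u = u * ⁅x, f⁆) (hx : ∀ u ∈ U, x ^ (p - 1) * u = u * x ^ (p - 1))
    (hf : ∀ u ∈ U, f ^ (p - 1) * u = u * f ^ (p - 1)) : False := by
  obtain ⟨a, ha⟩ := h.scalar hgen hc hx
  obtain ⟨b, hb⟩ := h.scalar (x := f) (f := x) (by rw [Set.pair_comm]; exact hgen) (by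
    intro u hu
    have := hc u hu
    rw [← commutatorElement_inv x f]
    have h2 : Commute ⁅x, f⁆ u := this
    exact h2.inv_left) hf
  have : Nontrivial U := (nontrivial_iff_ne_bot U).2 h.hne
  obtain ⟨c, hc1⟩ := exists_ne (1 : U)
  refine h.hcyc c c.2 (fun h => hc1 (Subtype.ext h)) (h.normal_of hgen ?_ (nz_closure ?_))
  · rw [zpowers_le]; exact c.2
  · rintro s hs y hy
    obtain ⟨k, rfl⟩ := mem_zpowers_iff.1 hy
    rw [← conj_zpow]
    refine zpow_mem ?_ k
    rcases hs with rfl | rfl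
    · rw [ha c c.2]; exact pow_mem (mem_zpowers _) _
    · rw [hb c c.2]; exact pow_mem (mem_zpowers _) _

lemma Chief.three (h : Chief p V U) (hle : ∀ q, q.Prime → q ∣ Nat.card Y → q ≤ p) {x : Y}
    (hx : ¬ ∀ u ∈ U, x * u = u * x) : 3 ≤ p := by
  by_contra hlt
  have hp2 : p = 2 := by have := hp.out.two_le; omega
  apply hx
  intro u hu
  refine h.cent (W := ⊤) inferInstance ?_ (mem_top x) hu
  have hc : IsPGroup p Y := by
    rw [IsPGroup.iff_card]
    refine ⟨_, Nat.eq_prime_pow_of_unique_prime_dvd Nat.card_pos.ne' ?_⟩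
    intro d hd hdv
    have := hle d hd hdv
    have := hd.two_le
    omega
  exact hc.to_subgroup ⊤

open Classical in
lemma Chief.dom (h : Chief p V U) (hle : ∀ q, q.Prime → q ∣ Nat.card Y → q ≤ p) {x f x1 x2 : Y}
    (hgen : closure {x, f} ⊔ V = ⊤) (hx : ¬ ∀ u ∈ U, x * u = u * x)
    (h1 : x⁻¹ * x1 ∈ V) (h2 : x⁻¹ * x2 ∈ V) :
    ∃ u ∈ U, ¬ IsSupersoluble (closure {x1, f * u}) ∧ ¬ IsSupersoluble (closure {x2, f * u}) := by
  have h3 := h.three hle hx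
  let C : Subgroup Y := U ⊓ centralizer {x}
  have hcen : ∀ y : Y, x⁻¹ * y ∈ V → ∀ t ∈ U, y * t = t * y → t ∈ C := by
    intro y hy t ht e
    refine mem_inf.2 ⟨ht, mem_centralizer_singleton_iff.2 ?_⟩
    have e1 := h.centV hy ht
    have : x * (x⁻¹ * y * t) = y * t := by group
    have h5 : x * (x⁻¹ * y * t) * y⁻¹ = t := by rw [this, e]; group
    have e3 : x * t * x⁻¹ = t := by
      rw [e1] at h5
      rw [← h5]
      rw [← h5] at e
      calc _ = x * t * x⁻¹ := by rw [h5]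
        _ = _ := by group
    have := mul_inv_eq_iff_eq_mul.1 e3
    exact this.symm
  have hCU : 2 * Nat.card C < Nat.card U := by
    have hne : C ≠ U := by
      intro e
      apply hx
      intro u hu
      rw [← e] at hu
      exact (mem_centralizer_singleton_iff.1 (mem_inf.1 hu).2).symm
    have hCle : C ≤ U := inf_le_left
    have hUp : IsPGroup p U := h.hVp.to_le h.hUV
    obtain ⟨n, hn⟩ := IsPGroup.iff_card.1 hUp
    obtain ⟨m, hm⟩ := IsPGroup.iff_card.1 (hUp.to_le hCle)
    have hlt : Nat.card C < Nat.card U := by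
      by_contra hge
      exact hne (Subgroup.eq_of_le_of_card_ge hCle (by omega))
    rw [hn, hm] at hlt ⊢
    have hmn : m < n := (Nat.pow_lt_pow_iff_right hp.out.one_lt).1 hlt
    have h5 : p ^ (m + 1) ≤ p ^ n := Nat.pow_le_pow_right hp.out.pos hmn
    rw [pow_succ] at h5
    have h6 : 0 < p ^ m := pow_pos hp.out.pos m
    nlinarith
  have hbad : ∀ y : Y, x⁻¹ * y ∈ V →
      Nat.card {u : U | IsSupersoluble (closure {y, f * (u : Y)})} ≤ Nat.card C := by
    intro y hy
    rcases isEmpty_or_nonempty {u : U | IsSupersoluble (closure {y, f * (u : Y)})} with he | ⟨⟨u0, hu0⟩⟩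
    · rw [Nat.card_of_isEmpty]; exact Nat.zero_le _
    have hVn := h.hV
    have hg2 : closure {y, f * (u0 : Y)} ⊔ V = ⊤ := by
      rw [eq_top_iff, ← hgen]
      refine sup_le ?_ le_sup_right
      rw [closure_le]
      rintro z (rfl | rfl)
      · have : z = y * (z⁻¹ * y)⁻¹ := by group
        rw [this]
        exact mul_mem (mem_sup_left (subset_closure (by simp))) (mem_sup_right (inv_mem hy))
      · have : z = z * u0 * (u0 : Y)⁻¹ := by group
        rw [this]
        exact mul_mem (mem_sup_left (subset_closure (by simp)))
          (mem_sup_right (inv_mem (h.hUV u0.2)))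
    have key : ∀ u : {u : U | IsSupersoluble (closure {y, f * (u : Y)})}, ∃ t : C,
        f * (u : Y) = (t : Y)⁻¹ * (f * u0) * t := by
      rintro ⟨u, hu⟩
      obtain ⟨t, ht, ht1, ht2⟩ := lemmaU h hle (u := (u0 : Y)⁻¹ * u) hg2 hu0
        (mul_mem (inv_mem u0.2) u.2) (by
          have : f * (u0 : Y) * ((u0 : Y)⁻¹ * u) = f * u := by group
          rw [this]; exact hu)
      refine ⟨⟨t, hcen y hy t ht ht1⟩, ?_⟩
      rw [← ht2]; simp
    choose T hT using key
    apply Nat.card_le_card_of_injective T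
    intro a b hab
    have : f * (a : Y) = f * (b : Y) := by rw [hT a, hab, ← hT b]
    apply Subtype.ext
    apply Subtype.ext
    exact mul_left_cancel this
  by_contra hcon
  push Not at hcon
  have hcov : (Set.univ : Set U) ⊆ {u : U | IsSupersoluble (closure {x1, f * (u : Y)})} ∪
      {u : U | IsSupersoluble (closure {x2, f * (u : Y)})} := by
    intro u _
    by_cases hu : IsSupersoluble (closure {x1, f * (u : Y)})
    · exact Or.inl hu
    · exact Or.inr (hcon u u.2 hu)
  have e1 := hbad x1 h1
  have e2 := hbad x2 h2
  have e3 := Set.ncard_le_ncard hcov (Set.toFinite _)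
  have e4 := Set.ncard_union_le {u : U | IsSupersoluble (closure {x1, f * (u : Y)})}
    {u : U | IsSupersoluble (closure {x2, f * (u : Y)})}
  rw [Set.ncard_univ] at e3
  rw [Nat.card_coe_set_eq] at e1 e2
  omega
end Eig
end NSG

namespace NSG
open Subgroup Relation
open scoped commutatorElement

section LB
set_option linter.unusedSectionVars false

lemma chief_exists {p : ℕ} {X : Type u} [Group X] [Finite X] {V : Subgroup X} (hV : V.Normal)
    (hVp : IsPGroup p V) (h : ¬ IsSupersoluble X) (hq : IsSupersoluble (X ⧸ V)) :
    ∃ (A B : Subgroup X) (hA : A.Normal), B ≤ V ∧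
      Chief p (V.map (QuotientGroup.mk' A)) (B.map (QuotientGroup.mk' A)) := by
  obtain ⟨A, B, hA, hB, hAB, hBA, hBV, hmin, hcyc⟩ := exists_bad_chief h hV hq
  refine ⟨A, B, hA, hBV, ?_⟩
  have hsurj := QuotientGroup.mk'_surjective A
  refine ⟨hV.map _ hsurj, hVp.map _, map_mono hBV, hB.map _ hsurj, ?_, ?_, ?_⟩
  · intro e
    apply hBA
    intro b hb
    have : QuotientGroup.mk' A b ∈ B.map (QuotientGroup.mk' A) := mem_map_of_mem _ hb
    rw [e, mem_bot] at this
    exact (QuotientGroup.eq_one_iff b).1 this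
  · intro C hC hCU hCne
    have hAC : A ≤ C.comap (QuotientGroup.mk' A) := by
      intro a ha
      have : QuotientGroup.mk' A a = 1 := (QuotientGroup.eq_one_iff a).2 ha
      rw [mem_comap, this]; exact one_mem _
    have := hmin (C.comap (QuotientGroup.mk' A)) (hC.comap _) hAC
      (by
        intro c hc
        obtain ⟨b, hb, e⟩ := hCU hc
        have h1 : b⁻¹ * c ∈ A := QuotientGroup.eq.1 e
        have := mul_mem hb (hAB h1)
        simpa using this)
      (by
        intro hle
        apply hCne
        rw [eq_bot_iff]
        intro c hc
        obtain ⟨d, rfl⟩ := hsurj c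
        rw [mem_bot]
        exact (QuotientGroup.eq_one_iff d).2 (hle hc))
    rw [← this, map_comap_eq_self_of_surjective hsurj]
  · rintro _ ⟨c, hc, rfl⟩ hc1 hn
    have hcA : c ∉ A := fun h => hc1 ((QuotientGroup.eq_one_iff c).2 h)
    apply hcyc c hc hcA
    have e : A ⊔ zpowers c = (zpowers (QuotientGroup.mk' A c)).comap (QuotientGroup.mk' A) := by
      rw [← MonoidHom.map_zpowers, comap_map_eq, QuotientGroup.ker_mk', sup_comm]
    rw [e]; exact hn.comap _

variable {p : ℕ} [hp : Fact p.Prime] {G : Type u} [Group G] [Finite G]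

def Edge {G : Type u} [Group G] (x y : G) : Prop := ¬ IsSupersoluble (closure {x, y})
def Bad {G : Type u} [Group G] (V : Subgroup G) (x f : G) : Prop := ¬ IsSupersoluble ↥(closure {x, f} ⊔ V)
def Dom {G : Type u} [Group G] (V : Subgroup G) (x f : G) : Prop :=
  ∀ x1 x2, x⁻¹ * x1 ∈ V → x⁻¹ * x2 ∈ V → ∃ f', f⁻¹ * f' ∈ V ∧ Edge x1 f' ∧ Edge x2 f'
def KK {G : Type u} [Group G] (V : Subgroup G) : Subgroup G := V ⊔ centralizer (V : Set G)

lemma Edge.symm {x y : G} (h : Edge x y) : Edge y x := by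
  unfold Edge at *; rwa [Set.pair_comm]

lemma Bad.symm {V : Subgroup G} {x y : G} (h : Bad V x y) : Bad V y x := by
  unfold Bad at *; rwa [Set.pair_comm]

lemma Edge.bad {V : Subgroup G} {x y : G} (h : Edge x y) : Bad V x y :=
  fun h' => h (ss_mono le_sup_left h')

lemma Edge.mono {x y x' y' : G} (h : Edge x y) (h' : closure {x, y} ≤ closure {x', y'}) : Edge x' y' :=
  fun hs => h (ss_mono h' hs)

lemma Edge.of_map {K : Type u} [Group K] (f : G →* K) {x y : G} (h : Edge (f x) (f y)) : Edge x y := by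
  intro hs
  apply h
  have := ss_map f hs
  rwa [MonoidHom.map_closure, Set.image_pair] at this

lemma KK_normal {V : Subgroup G} (hV : V.Normal) : (KK V).Normal := by
  unfold KK; infer_instance

theorem LBcore {V : Subgroup G} (hV : V.Normal) (hVp : IsPGroup p V)
    (hle : ∀ q, q.Prime → q ∣ Nat.card G → q ≤ p) {x f : G} (hbad : Bad V x f)
    (hq : ¬ Edge (x : G ⧸ V) (f : G ⧸ V)) :
    ∃ Z : Subgroup G, (∀ a b : G, closure {a, b} ⊔ V = closure {x, f} ⊔ V → a ∉ Z → Dom V a b) ∧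
      ¬ (⁅x, f⁆ ∈ Z ∧ x ^ (p - 1) ∈ Z ∧ f ^ (p - 1) ∈ Z) ∧
      (KK V ⊓ (closure {x, f} ⊔ V) ≤ Z) ∧
      (∀ g ∈ closure {x, f} ⊔ V, ∀ z ∈ Z, g * z * g⁻¹ ∈ Z) := by
  set X := closure {x, f} ⊔ V with hX
  have hVX : V ≤ X := le_sup_right
  have hVn : (V.subgroupOf X).Normal := inferInstance
  have hVp' : IsPGroup p (V.subgroupOf X) :=
    hVp.of_injective ((Subgroup.subgroupOfEquivOfLe hVX).toMonoidHom) (MulEquiv.injective _)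
  have hqs : IsSupersoluble (X ⧸ V.subgroupOf X) := by
    have h0 : IsSupersoluble (closure {(x : G ⧸ V), (f : G ⧸ V)}) := by
      by_contra h; exact hq h
    let F : X →* G ⧸ V := (QuotientGroup.mk' V).comp X.subtype
    have hF : ∀ y : X, F y ∈ closure {(x : G ⧸ V), (f : G ⧸ V)} := by
      intro y
      have : X ≤ (closure {(x : G ⧸ V), (f : G ⧸ V)}).comap (QuotientGroup.mk' V) := by
        refine sup_le ?_ ?_
        · rw [closure_le]
          rintro z (rfl | rfl)
          · exact subset_closure (by simp)
          · exact subset_closure (by simp)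
        · intro v hv
          have : QuotientGroup.mk' V v = 1 := (QuotientGroup.eq_one_iff v).2 hv
          rw [mem_comap, this]; exact one_mem _
      exact this y.2
    let F' : X ⧸ V.subgroupOf X →* closure {(x : G ⧸ V), (f : G ⧸ V)} :=
      QuotientGroup.lift _ (F.codRestrict _ hF) (by
        intro y hy
        apply Subtype.ext
        exact (QuotientGroup.eq_one_iff (y : G)).2 hy)
    refine ss_of_injective F' ?_ h0
    rw [injective_iff_map_eq_one]
    intro a ha
    obtain ⟨y, rfl⟩ := QuotientGroup.mk_surjective a
    have h1 := congrArg Subtype.val ha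
    have h2 : ((y : G) : G ⧸ V) = 1 := h1
    exact (QuotientGroup.eq_one_iff y).2 ((QuotientGroup.eq_one_iff (y : G)).1 h2)
  obtain ⟨A, B, hA, hBV, hch⟩ := chief_exists hVn hVp' hbad hqs
  set π := QuotientGroup.mk' A with hπ
  have hsurj : Function.Surjective π := QuotientGroup.mk'_surjective A
  set U := B.map π with hU
  have hUn := hch.hU
  have hcardX : Nat.card X ∣ Nat.card G := card_subgroup_dvd_card X
  have hleY : ∀ q, q.Prime → q ∣ Nat.card (X ⧸ A) → q ≤ p := fun q hq hd =>
    hle q hq ((hd.trans (card_quotient_dvd_card A)).trans hcardX)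
  have hxX : x ∈ X := mem_sup_left (subset_closure (by simp))
  have hfX : f ∈ X := mem_sup_left (subset_closure (by simp))
  have hgen : ∀ (a b : G) (ha : a ∈ X) (hb : b ∈ X), closure {a, b} ⊔ V = X →
      closure {π ⟨a, ha⟩, π ⟨b, hb⟩} ⊔ (V.subgroupOf X).map π = ⊤ := by
    intro a b ha hb e
    have e1 : closure {(⟨a, ha⟩ : X), ⟨b, hb⟩} ⊔ V.subgroupOf X = ⊤ := by
      apply map_injective X.subtype_injective
      rw [Subgroup.map_sup, MonoidHom.map_closure, Set.image_pair, subgroupOf_map_subtype,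
        inf_eq_left.2 hVX, ← MonoidHom.range_eq_map, range_subtype]
      exact e
    rw [← map_top_of_surjective π hsurj, ← e1, Subgroup.map_sup, MonoidHom.map_closure, Set.image_pair]
  have hZ : ∀ (g : G) (hg : g ∈ X), g ∈ ((centralizer (U : Set (X ⧸ A))).comap π).map X.subtype ↔
      ∀ u ∈ U, π ⟨g, hg⟩ * u = u * π ⟨g, hg⟩ := by
    intro g hg
    constructor
    · rintro ⟨⟨g', hg'⟩, h, rfl⟩ u hu
      exact (mem_centralizer_iff.1 h u hu).symm
    · intro h
      exact ⟨⟨g, hg⟩, mem_centralizer_iff.2 fun u hu => (h u hu).symm, rfl⟩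
  refine ⟨((centralizer (U : Set (X ⧸ A))).comap π).map X.subtype, ?_, ?_, ?_, ?_⟩
  · intro a b hab haZ x1 x2 h1 h2
    have haX : a ∈ X := by rw [← hab]; exact mem_sup_left (subset_closure (by simp))
    have hbX : b ∈ X := by rw [← hab]; exact mem_sup_left (subset_closure (by simp))
    rw [hZ a haX] at haZ
    have hx1 : x1 ∈ X := by have := mul_mem haX (hVX h1); simpa using this
    have hx2 : x2 ∈ X := by have := mul_mem haX (hVX h2); simpa using this
    obtain ⟨u, hu, e1, e2⟩ := hch.dom hleY (x1 := π ⟨x1, hx1⟩) (x2 := π ⟨x2, hx2⟩)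
      (hgen a b haX hbX hab) haZ ⟨⟨a, haX⟩⁻¹ * ⟨x1, hx1⟩, h1, by rw [map_mul, map_inv]⟩
      ⟨⟨a, haX⟩⁻¹ * ⟨x2, hx2⟩, h2, by rw [map_mul, map_inv]⟩
    obtain ⟨v, hv, rfl⟩ := hu
    rw [← map_mul] at e1 e2
    refine ⟨b * v, ?_, ?_, ?_⟩
    · have : (v : G) ∈ V := hBV hv
      simpa using this
    · have h3 : Edge (π ⟨x1, hx1⟩) (π (⟨b, hbX⟩ * v)) := e1
      have h4 := h3.of_map
      intro hs
      apply h4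
      apply ss_of_map_inj X.subtype X.subtype_injective
      rw [MonoidHom.map_closure, Set.image_pair]; exact hs
    · have h3 : Edge (π ⟨x2, hx2⟩) (π (⟨b, hbX⟩ * v)) := e2
      have h4 := h3.of_map
      intro hs
      apply h4
      apply ss_of_map_inj X.subtype X.subtype_injective
      rw [MonoidHom.map_closure, Set.image_pair]; exact hs
  · rintro ⟨h1, h2, h3⟩
    have hcX : ⁅x, f⁆ ∈ X := by
      rw [commutatorElement_def]
      exact mul_mem (mul_mem (mul_mem hxX hfX) (inv_mem hxX)) (inv_mem hfX)
    rw [hZ _ hcX] at h1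
    rw [hZ _ (pow_mem hxX _)] at h2
    rw [hZ _ (pow_mem hfX _)] at h3
    exact hch.eig (hgen x f hxX hfX rfl) h1 h2 h3
  · rintro g hg
    obtain ⟨hgK, hgX⟩ := mem_inf.1 hg
    have hgK' : g ∈ centralizer (V : Set G) ⊔ V := by rw [sup_comm]; exact hgK
    rw [mem_sup_of_normal_right] at hgK'
    obtain ⟨c, hc, v, hv, rfl⟩ := hgK'
    have hcX : c ∈ X := by
      have := mul_mem hgX (inv_mem (hVX hv)); simpa using this
    refine mul_mem ?_ ?_
    · rw [hZ c hcX]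
      rintro _ ⟨b, hb, rfl⟩
      rw [← map_mul, ← map_mul]
      congr 1
      exact Subtype.ext (mem_centralizer_iff.1 hc b (hBV hb)).symm
    · rw [hZ v (hVX hv)]
      intro u hu
      exact hch.centV ⟨⟨v, hVX hv⟩, hv, rfl⟩ hu
  · rintro g hg _ ⟨z, hz, rfl⟩
    have hcn : (centralizer (U : Set (X ⧸ A))).Normal := inferInstance
    exact ⟨⟨g, hg⟩ * z * ⟨g, hg⟩⁻¹, (hcn.comap π).conj_mem z hz _, rfl⟩

def Tame {G : Type u} [Group G] (p : ℕ) (V : Subgroup G) (x f : G) : Prop :=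
  ⁅x, f⁆ ∈ KK V ∧ x ^ (p - 1) ∈ KK V ∧ f ^ (p - 1) ∈ KK V

lemma dom_of_quot {V : Subgroup G} (hV : V.Normal) {x f : G} (h : Edge (x : G ⧸ V) (f : G ⧸ V)) :
    Dom V x f := by
  intro x1 x2 h1 h2
  refine ⟨f, by simp, ?_, ?_⟩
  · apply Edge.of_map (QuotientGroup.mk' V)
    have : (x : G ⧸ V) = x1 := QuotientGroup.eq.2 h1
    rw [this] at h
    exact h
  · apply Edge.of_map (QuotientGroup.mk' V)
    have : (x : G ⧸ V) = x2 := QuotientGroup.eq.2 h2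
    rw [this] at h
    exact h

theorem LB {V : Subgroup G} (hV : V.Normal) (hVp : IsPGroup p V)
    (hle : ∀ q, q.Prime → q ∣ Nat.card G → q ≤ p) {x f : G} (hbad : Bad V x f) :
    (Edge (x : G ⧸ V) (f : G ⧸ V) ∧ Dom V x f ∧ Dom V f x) ∨
    (¬ Tame p V x f ∧ Dom V x f ∧ Dom V f x) ∨
    (x ^ (p - 1) ∉ KK V ∧ Dom V x f ∧ Dom V (f * x) x ∧ Dom V x (f * x)) ∨
    (f ^ (p - 1) ∉ KK V ∧ Dom V f x ∧ Dom V (x * f) f ∧ Dom V f (x * f)) := by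
  by_cases hq : Edge (x : G ⧸ V) (f : G ⧸ V)
  · exact Or.inl ⟨hq, dom_of_quot hV hq, dom_of_quot hV hq.symm⟩
  right
  obtain ⟨Z, h1, h2, h3, h4⟩ := LBcore hV hVp hle hbad hq
  have hxX : x ∈ closure {x, f} ⊔ V := mem_sup_left (subset_closure (by simp))
  have hfX : f ∈ closure {x, f} ⊔ V := mem_sup_left (subset_closure (by simp))
  have hcl : ∀ a b : G, closure {b * a, a} = closure {a, b} := by
    intro a b
    apply le_antisymm
    · rw [closure_le]
      rintro z (rfl | rfl)
      · exact mul_mem (subset_closure (by simp)) (subset_closure (by simp))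
      · exact subset_closure (by simp)
    · rw [closure_le]
      rintro z (rfl | rfl)
      · exact subset_closure (by simp)
      · have : z = z * a * a⁻¹ := by group
        rw [this]
        exact mul_mem (subset_closure (by simp)) (inv_mem (subset_closure (by simp)))
  have hnK : ∀ g ∈ closure {x, f} ⊔ V, g ∉ Z → g ∉ KK V := fun g hg hgZ hgK => hgZ (h3 (mem_inf.2 ⟨hgK, hg⟩))
  by_cases hx : x ∈ Z
  · right; right
    have hxf : ⁅x, f⁆ ∈ Z := by
      have := mul_mem hx (h4 f hfX _ (inv_mem hx))
      rw [commutatorElement_def]; simpa [mul_assoc] using this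
    have hf : f ^ (p - 1) ∉ Z := fun h => h2 ⟨hxf, pow_mem hx _, h⟩
    have hf1 : f ∉ Z := fun h => hf (pow_mem h _)
    refine ⟨hnK _ (pow_mem hfX _) hf, h1 _ _ (by rw [Set.pair_comm f]) hf1,
      h1 _ _ (by rw [hcl, Set.pair_comm]) (fun h => hf1 ?_),
      h1 _ _ (by rw [Set.pair_comm f, hcl, Set.pair_comm]) hf1⟩
    have := mul_mem (inv_mem hx) h
    simpa using this
  · by_cases hf : f ∈ Z
    · right; left
      have hxf : ⁅x, f⁆ ∈ Z := by
        have := mul_mem (h4 x hxX _ hf) (inv_mem hf)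
        rw [commutatorElement_def]; exact this
      have hx' : x ^ (p - 1) ∉ Z := fun h => h2 ⟨hxf, h, pow_mem hf _⟩
      refine ⟨hnK _ (pow_mem hxX _) hx', h1 _ _ rfl hx, h1 _ _ (by rw [hcl]) (fun h => hx ?_),
        h1 _ _ (by rw [Set.pair_comm x, hcl]) hx⟩
      have := mul_mem (inv_mem hf) h
      simpa using this
    · left
      refine ⟨?_, h1 _ _ rfl hx, h1 _ _ (by rw [Set.pair_comm f]) hf⟩
      rintro ⟨e1, e2, e3⟩
      refine h2 ⟨h3 (mem_inf.2 ⟨e1, ?_⟩), h3 (mem_inf.2 ⟨e2, pow_mem hxX _⟩),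
        h3 (mem_inf.2 ⟨e3, pow_mem hfX _⟩)⟩
      rw [commutatorElement_def]
      exact mul_mem (mul_mem (mul_mem hxX hfX) (inv_mem hxX)) (inv_mem hfX)
end LB
end NSG

namespace NSG
open Subgroup Relation
open scoped commutatorElement

section P5
set_option linter.unusedSectionVars false
variable {p : ℕ} [hp : Fact p.Prime] {G : Type u} [Group G] [Finite G]

lemma exists_split (p : ℕ) [hp : Fact p.Prime] (G : Type u) [Group G] [Finite G] :
    ∃ m e n : ℕ, p.Coprime n ∧ ∀ g : G, g ^ m * g ^ e = g ∧ (g ^ m) ^ n = 1 ∧ PEl p (g ^ e) ∧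
      (PEl p g → g ^ e = g) := by
  obtain ⟨a, n, hn, hN⟩ := Nat.exists_eq_pow_mul_and_not_dvd (Nat.card_pos (α := G)).ne' p hp.out.ne_one
  have hcn : p.Coprime n := (hp.out.coprime_iff_not_dvd).2 hn
  have hc : Nat.Coprime (p ^ a) n := hcn.pow_left a
  obtain ⟨e, he1, he2⟩ := Nat.chineseRemainder hc 1 0
  obtain ⟨m, hm1, hm2⟩ := Nat.chineseRemainder hc 0 1
  have hNg : ∀ g : G, g ^ (p ^ a * n) = 1 := fun g => by rw [← hN]; exact pow_card_eq_one'
  have hnd : n ∣ e := (Nat.modEq_zero_iff_dvd).1 he2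
  have hpm : p ^ a ∣ m := (Nat.modEq_zero_iff_dvd).1 hm1
  refine ⟨m, e, n, hcn, fun g => ⟨?_, ?_, ?_, ?_⟩⟩
  · have h1 : m + e ≡ 1 [MOD p ^ a * n] := by
      rw [← Nat.modEq_and_modEq_iff_modEq_mul hc]
      exact ⟨by simpa using hm1.add he1, by simpa using hm2.add he2⟩
    rw [← pow_add]
    have : g ^ (m + e) = g ^ 1 := by
      rw [pow_eq_pow_iff_modEq]
      exact h1.of_dvd (orderOf_dvd_of_pow_eq_one (hNg g))
    rw [this, pow_one]
  · obtain ⟨k, rfl⟩ := hpm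
    rw [← pow_mul, mul_right_comm, pow_mul, hNg, one_pow]
  · obtain ⟨k, rfl⟩ := hnd
    refine ⟨a, ?_⟩
    rw [← pow_mul, mul_right_comm, mul_comm n, pow_mul, hNg, one_pow]
  · rintro ⟨k, hk⟩
    have h1 : g ^ (p ^ a) = 1 := by
      have d1 : orderOf g ∣ p ^ k := orderOf_dvd_of_pow_eq_one hk
      have d2 : orderOf g ∣ p ^ a * n := orderOf_dvd_of_pow_eq_one (hNg g)
      have : Nat.Coprime (orderOf g) n := Nat.Coprime.coprime_dvd_left d1 (hcn.pow_left k)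
      exact orderOf_dvd_iff_pow_eq_one.1 (this.dvd_of_dvd_mul_right d2)
    have : g ^ e = g ^ 1 := by
      rw [pow_eq_pow_iff_modEq]
      exact he1.of_dvd (orderOf_dvd_of_pow_eq_one h1)
    rw [this, pow_one]

/-- `g` acts trivially on all normal cyclic subgroups of order `p` of quotients -/
def ActTriv (p : ℕ) {X : Type u} [Group X] (g : X) : Prop :=
  ∀ (A : Subgroup X) (_ : A.Normal) (c : X ⧸ A), orderOf c = p → (zpowers c).Normal →
    (g : X ⧸ A) * c = c * g

lemma conj_act {X : Type u} [Group X] [Finite X] {c : X} (hc : orderOf c = p) (hn : (zpowers c).Normal)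
    (x f : X) : ⁅x, f⁆ * c = c * ⁅x, f⁆ ∧ x ^ (p - 1) * c = c * x ^ (p - 1) := by
  have hcard : Nat.card (zpowers c) = p := by rw [Nat.card_zpowers, hc]
  have key : ∀ g : X, MulAut.conjNormal (H := zpowers c) g = 1 → g * c = c * g := by
    intro g hg
    have h1 : MulAut.conjNormal (H := zpowers c) g ⟨c, mem_zpowers c⟩ = ⟨c, mem_zpowers c⟩ := by
      rw [hg]; rfl
    have h2 := congrArg Subtype.val h1
    rw [MulAut.conjNormal_apply] at h2
    exact mul_inv_eq_iff_eq_mul.1 h2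
  constructor
  · apply key
    rw [map_commutatorElement, commutatorElement_eq_one_iff_mul_comm]
    exact (IsCyclic.mulAutMulEquiv (zpowers c)).injective (by rw [map_mul, map_mul, mul_comm])
  · apply key
    rw [map_pow]
    have := pow_card_eq_one' (x := MulAut.conjNormal (H := zpowers c) x)
    rwa [IsCyclic.card_mulAut, hcard, Nat.totient_prime hp.out] at this

lemma actTriv_comm {X : Type u} [Group X] [Finite X] (x f : X) : ActTriv p ⁅x, f⁆ := by
  intro A hA c hc hn
  have := (conj_act hc hn (x : X ⧸ A) (f : X ⧸ A)).1
  rwa [← QuotientGroup.mk'_apply, ← QuotientGroup.mk'_apply, ← map_commutatorElement] at this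

lemma actTriv_pow {X : Type u} [Group X] [Finite X] (x : X) : ActTriv p (x ^ (p - 1)) := by
  intro A hA c hc hn
  exact (conj_act hc hn (x : X ⧸ A) 1).2

lemma refine_cyc {X : Type u} [Group X] [Finite X] {V A : Subgroup X} (hVp : IsPGroup p V)
    (hA : A.Normal) {c : X} (hc : c ∈ V) (hcA : c ∉ A) (hn : (A ⊔ zpowers c).Normal) :
    ∃ d ∈ V, d ∉ A ∧ orderOf (d : X ⧸ A) = p ∧ (zpowers (d : X ⧸ A)).Normal := by
  have hn' : (zpowers (c : X ⧸ A)).Normal := by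
    have := hn.map (QuotientGroup.mk' A) (QuotientGroup.mk'_surjective A)
    rw [Subgroup.map_sup, QuotientGroup.map_mk'_self, bot_sup_eq, MonoidHom.map_zpowers] at this
    exact this
  obtain ⟨k, hk⟩ := (PEl.of_mem hVp hc).map (QuotientGroup.mk' A)
  have hk' : orderOf (c : X ⧸ A) ∣ p ^ k := orderOf_dvd_of_pow_eq_one hk
  obtain ⟨j, hj, hjo⟩ := (Nat.dvd_prime_pow hp.out).1 hk'
  have hj0 : j ≠ 0 := by
    rintro rfl
    rw [pow_zero, orderOf_eq_one_iff] at hjo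
    exact hcA ((QuotientGroup.eq_one_iff c).1 hjo)
  have hord : orderOf ((c ^ (p ^ (j - 1)) : X) : X ⧸ A) = p := by
    rw [QuotientGroup.mk_pow, orderOf_pow_of_dvd (pow_ne_zero _ hp.out.ne_zero)
      (by rw [hjo]; exact pow_dvd_pow p (by omega)), hjo, Nat.pow_div (by omega) hp.out.pos]
    have : j - (j - 1) = 1 := by omega
    rw [this, pow_one]
  refine ⟨c ^ (p ^ (j - 1)), pow_mem hc _, ?_, hord, ?_⟩
  · intro h
    have : ((c ^ (p ^ (j - 1)) : X) : X ⧸ A) = 1 := (QuotientGroup.eq_one_iff _).2 h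
    rw [this, orderOf_one] at hord
    exact hp.out.one_lt.ne hord
  · constructor
    intro n hnm g
    obtain ⟨i, rfl⟩ := mem_zpowers_iff.1 hnm
    obtain ⟨l, hl⟩ := mem_zpowers_iff.1 (hn'.conj_mem _ (mem_zpowers _) g)
    rw [← conj_zpow]
    refine zpow_mem ?_ i
    rw [QuotientGroup.mk_pow, ← conj_pow, ← hl]
    refine mem_zpowers_iff.2 ⟨l, ?_⟩
    rw [← zpow_natCast, ← zpow_natCast, ← zpow_mul, ← zpow_mul, mul_comm]

lemma act_cent {X : Type u} [Group X] [Finite X] {V : Subgroup X} (hV : V.Normal) (hVp : IsPGroup p V)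
    (hss : IsSupersoluble X) (hall : ∀ w : X, PEl p w → w ∈ V) {g : X} (hg : ActTriv p g) :
    g ∈ V ⊔ centralizer (V : Set X) := by
  obtain ⟨m, e, n, hcop, hsp⟩ := exists_split p X
  obtain ⟨h1, h2, h3, -⟩ := hsp g
  rw [← h1]
  refine mul_mem (mem_sup_right ?_) (mem_sup_left (hall _ h3))
  have hfin : {A : Subgroup X | A.Normal ∧ A ≤ V ∧ ∀ a ∈ A, g ^ m * a = a * g ^ m}.Finite := Set.toFinite _
  obtain ⟨A, hA⟩ := hfin.exists_maximal ⟨⊥, inferInstance, bot_le, by simp⟩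
  obtain ⟨hAn, hAV, hAc⟩ := hA.1
  by_cases hVA : V ≤ A
  · exact mem_centralizer_iff.2 fun v hv => (hAc v (hVA hv)).symm
  exfalso
  obtain ⟨c0, hc0, hc0A, hn0⟩ := ss_cf hss hAn hV hVA
  obtain ⟨c, hc, hcA, hord, hn⟩ := refine_cyc hVp hAn hc0 hc0A hn0
  have hgc := hg A hAn c hord hn
  have hyc : ((g ^ m : X) : X ⧸ A) * c = c * ((g ^ m : X) : X ⧸ A) := by
    have : Commute (g : X ⧸ A) c := hgc
    rw [QuotientGroup.mk_pow]
    exact this.pow_left m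
  set y := g ^ m with hy
  obtain ⟨a, ha, hya⟩ : ∃ a ∈ A, y * c * y⁻¹ = c * a := by
    refine ⟨c⁻¹ * (y * c * y⁻¹), ?_, by group⟩
    apply QuotientGroup.eq.1
    rw [QuotientGroup.mk_mul, QuotientGroup.mk_mul, hyc, QuotientGroup.mk_inv, mul_inv_cancel_right]
  have hiter : ∀ k : ℕ, y ^ k * c * (y ^ k)⁻¹ = c * a ^ k := by
    intro k
    induction k with
    | zero => simp
    | succ k ih =>
      have e1 : y ^ (k + 1) * c * (y ^ (k + 1))⁻¹ = y * (y ^ k * c * (y ^ k)⁻¹) * y⁻¹ := by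
        rw [pow_succ']; group
      have e2 : y * a ^ k = a ^ k * y := hAc _ (pow_mem ha k)
      rw [e1, ih]
      calc y * (c * a ^ k) * y⁻¹ = y * c * y⁻¹ * (y * a ^ k) * y⁻¹ := by group
        _ = c * a * a ^ k := by rw [e2, hya]; group
        _ = _ := by rw [pow_succ', mul_assoc]
  have hn1 := hiter n
  rw [h2] at hn1
  have han : a ^ n = 1 := by simpa using hn1
  obtain ⟨k, hk⟩ := PEl.of_mem hVp (hAV ha)
  have ha1 : a = 1 := by
    have d1 := orderOf_dvd_of_pow_eq_one han
    have d2 := orderOf_dvd_of_pow_eq_one hk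
    exact orderOf_eq_one_iff.1 (Nat.eq_one_of_dvd_coprimes (hcop.pow_left k) d2 d1)
  have hyc1 : y * c = c * y := by
    rw [ha1, mul_one] at hya
    exact mul_inv_eq_iff_eq_mul.1 hya
  have hBn : (A ⊔ zpowers c).Normal := by
    have e : A ⊔ zpowers c = (zpowers (QuotientGroup.mk' A c)).comap (QuotientGroup.mk' A) := by
      rw [← MonoidHom.map_zpowers, comap_map_eq, QuotientGroup.ker_mk', sup_comm]
    rw [e]; exact hn.comap _
  have hle : A ⊔ zpowers c ≤ A := by
    refine hA.2 ⟨hBn, sup_le hAV (by rw [zpowers_le]; exact hc), ?_⟩ le_sup_left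
    have : A ⊔ zpowers c ≤ centralizer {y} := by
      refine sup_le ?_ ?_
      · intro a ha
        exact mem_centralizer_singleton_iff.2 (hAc a ha).symm
      · rw [zpowers_le]
        exact mem_centralizer_singleton_iff.2 hyc1.symm
    intro b hb
    exact (mem_centralizer_singleton_iff.1 (this hb)).symm
  exact hcA (hle (mem_sup_right (mem_zpowers c)))

theorem tame_of_not_bad {V : Subgroup G} (hV : V.Normal) (hVp : IsPGroup p V)
    (hall : ∀ w : G, PEl p w → w ∈ V) {x f : G} (h : ¬ Bad V x f) : Tame p V x f := by
  have hss : IsSupersoluble ↥(closure {x, f} ⊔ V) := by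
    by_contra hc; exact h hc
  set X := closure {x, f} ⊔ V with hX
  have hVX : V ≤ X := le_sup_right
  have hxX : x ∈ X := mem_sup_left (subset_closure (by simp))
  have hfX : f ∈ X := mem_sup_left (subset_closure (by simp))
  have hVp' : IsPGroup p (V.subgroupOf X) :=
    hVp.of_injective ((Subgroup.subgroupOfEquivOfLe hVX).toMonoidHom) (MulEquiv.injective _)
  have key : ∀ g : X, ActTriv p g → (g : G) ∈ KK V := by
    intro g hg
    have h1 := act_cent (V := V.subgroupOf X) inferInstance hVp' hss
      (fun w hw => hall w (hw.map X.subtype)) hg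
    rw [mem_sup_of_normal_left] at h1
    obtain ⟨v, hv, c, hc, rfl⟩ := h1
    refine mul_mem (mem_sup_left hv) (mem_sup_right ?_)
    refine mem_centralizer_iff.2 fun w hw => ?_
    exact congrArg Subtype.val (mem_centralizer_iff.1 hc ⟨w, hVX hw⟩ hw)
  refine ⟨?_, ?_, ?_⟩
  · exact key ⁅⟨x, hxX⟩, ⟨f, hfX⟩⁆ (actTriv_comm _ _)
  · exact key (⟨x, hxX⟩ ^ (p - 1)) (actTriv_pow _)
  · exact key (⟨f, hfX⟩ ^ (p - 1)) (actTriv_pow _)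

end P5
end NSG

namespace NSG
open Subgroup Relation
open scoped commutatorElement

section P6
set_option linter.unusedSectionVars false
variable {p : ℕ} [hp : Fact p.Prime] {G : Type u} [Group G] [Finite G]

def NI {G : Type u} [Group G] (x : G) : Prop := ∃ u, Edge x u
def Closed {G : Type u} [Group G] (A : Set G) : Prop := ∀ x y, Edge x y → (x ∈ A ↔ y ∈ A)

lemma Closed.compl {A : Set G} (h : Closed A) : Closed Aᶜ := fun x y e => not_congr (h x y e)

lemma edge_pow {x v : G} {k : ℕ} (h : Edge (x ^ k) v) : Edge x v := by
  refine h.mono ?_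
  rw [closure_le]
  rintro z (rfl | rfl)
  · exact pow_mem (subset_closure (by simp)) k
  · exact subset_closure (by simp)

lemma comm_mem_iff {N : Subgroup G} [N.Normal] {a b : G} :
    ⁅a, b⁆ ∈ N ↔ (a : G ⧸ N) * b = b * a := by
  rw [← QuotientGroup.eq_one_iff, ← commutatorElement_eq_one_iff_mul_comm]
  exact Iff.of_eq (congrArg (· = 1) (map_commutatorElement (QuotientGroup.mk' N) a b))

lemma hle_quot {V : Subgroup G} (hle : ∀ q, q.Prime → q ∣ Nat.card G → q ≤ p) :
    ∀ q, q.Prime → q ∣ Nat.card (G ⧸ V) → q ≤ p :=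
  fun q hq hd => hle q hq (hd.trans (card_quotient_dvd_card V))

lemma edge_lift {V : Subgroup G} [V.Normal] {x y : G} (h : Edge (x : G ⧸ V) (y : G ⧸ V)) : Edge x y :=
  Edge.of_map (QuotientGroup.mk' V) h

lemma ni_lift {V : Subgroup G} [V.Normal] {x : G} (h : NI (x : G ⧸ V)) : NI x := by
  obtain ⟨u, hu⟩ := h
  obtain ⟨u, rfl⟩ := QuotientGroup.mk_surjective u
  exact ⟨u, edge_lift hu⟩

lemma lemmaH {V : Subgroup G} [V.Normal] (hV : V = Op p G)
    (hle : ∀ q, q.Prime → q ∣ Nat.card G → q ≤ p) (d : G) (hex : ∃ w, PEl p w ∧ w ∉ V)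
    (hd : ∀ w, PEl p w → w ∉ V → ¬ Edge d w) :
    ∃ w : G, PEl p w ∧ w ∉ V ∧ (d : G ⧸ V) * w = w * d := by
  have hVp : IsPGroup p V := by rw [hV]; exact Op_pgroup
  have hO := Op_quot p G V hV
  by_contra hcon
  push Not at hcon
  obtain ⟨w0, pw0, hw0⟩ := hex
  have := lemmaF (p := p) (d : G ⧸ V) ?_ ?_ (w0 : G ⧸ V) (pw0.map (QuotientGroup.mk' V))
  · rw [hO, mem_bot, QuotientGroup.eq_one_iff] at this
    exact hw0 this
  · intro w pw
    obtain ⟨w, rfl⟩ := QuotientGroup.mk_surjective w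
    have pw' : PEl p w := PEl.of_quot hVp pw
    by_cases hw : w ∈ V
    · refine ⟨⊥, IsPGroup.of_bot, ?_, ?_⟩
      · rw [mem_bot, QuotientGroup.eq_one_iff]; exact hw
      · intro t ht
        rw [mem_bot] at ht; subst ht; simp
    have hss : IsSupersoluble (closure {d, w}) := by
      by_contra h; exact hd w pw' hw h
    have hm := ss_pel_in hss hle pw' (subset_closure (by simp))
    refine ⟨(OpIn p (closure {d, w})).map (QuotientGroup.mk' V), OpIn_pgroup.map _, ⟨w, hm, rfl⟩, ?_⟩
    rintro _ ⟨t, ht, rfl⟩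
    exact ⟨d * t * d⁻¹, OpIn_nz (subset_closure (by simp)) ht, rfl⟩
  · intro w pw hc
    obtain ⟨w, rfl⟩ := QuotientGroup.mk_surjective w
    by_contra hw
    exact hcon w (PEl.of_quot hVp pw) (fun h => hw ((QuotientGroup.eq_one_iff w).2 h)) hc

lemma ni_pel {V : Subgroup G} [V.Normal] (hV : V = Op p G)
    (hle : ∀ q, q.Prime → q ∣ Nat.card G → q ≤ p) {w : G} (pw : PEl p w) (hw : w ∉ V) : NI w := by
  have hO := Op_quot p G V hV
  obtain ⟨k, hk⟩ := neighbour hO (fun a b pa pb ha hb => thmP p pa pb (by rwa [hO, mem_bot])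
    (by rwa [hO, mem_bot])) (w : G ⧸ V) (pw.map (QuotientGroup.mk' V))
    (fun h => hw ((QuotientGroup.eq_one_iff w).1 h))
  exact ni_lift (V := V) ⟨k, padj_not_ss (hle_quot hle) hk⟩

lemma color_pel {V : Subgroup G} (hV : V = Op p G)
    (hle : ∀ q, q.Prime → q ∣ Nat.card G → q ≤ p) {A : Set G} (hA : Closed A) {w w' : G}
    (pw : PEl p w) (hw : w ∉ V) (pw' : PEl p w') (hw' : w' ∉ V) : w ∈ A ↔ w' ∈ A := by
  subst hV
  exact thmP p pw pw' hw hw' A fun x y h => hA x y (padj_not_ss hle h)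

lemma split_mul {V : Subgroup G} [V.Normal] {m e : ℕ} {d w : G} (hd : d ^ m * d ^ e = d)
    (hw : w ^ m * w ^ e = w) (hw2 : w ^ e = w) (hde : d ^ e ∈ V) (hwV : w ∉ V)
    (hc : (d : G ⧸ V) * w = w * d) : (d * w) ^ e ∉ V ∧ d⁻¹ * (d * w) ^ m ∈ V := by
  have hc' : Commute (d : G ⧸ V) w := hc
  have h1 : (d : G ⧸ V) ^ e = 1 := by
    rw [← QuotientGroup.mk_pow, QuotientGroup.eq_one_iff]; exact hde
  have hwm : w ^ m = 1 := by
    rw [hw2] at hw; exact mul_eq_right.1 hw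
  constructor
  · rw [← QuotientGroup.eq_one_iff, QuotientGroup.mk_pow, QuotientGroup.mk_mul, hc'.mul_pow, h1, one_mul,
      ← QuotientGroup.mk_pow, hw2, QuotientGroup.eq_one_iff]
    exact hwV
  · rw [← QuotientGroup.eq, QuotientGroup.mk_pow, QuotientGroup.mk_mul, hc'.mul_pow,
      ← QuotientGroup.mk_pow V w, hwm, QuotientGroup.mk_one, mul_one]
    conv_lhs => rw [← hd]
    rw [QuotientGroup.mk_mul, QuotientGroup.mk_pow, QuotientGroup.mk_pow, h1, mul_one]

lemma exists_max_prime (h : Nat.card G ≠ 1) :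
    ∃ p : ℕ, p.Prime ∧ p ∣ Nat.card G ∧ ∀ q, q.Prime → q ∣ Nat.card G → q ≤ p := by
  have hne : (Nat.card G).primeFactors.Nonempty :=
    ⟨_, Nat.mem_primeFactors.2 ⟨Nat.minFac_prime h, Nat.minFac_dvd _, Nat.card_pos.ne'⟩⟩
  obtain ⟨p, hp, hm⟩ := Finset.exists_max_image _ id hne
  have := Nat.mem_primeFactors.1 hp
  exact ⟨p, this.1, this.2.1, fun q hq hd => hm q (Nat.mem_primeFactors.2 ⟨hq, hd, Nat.card_pos.ne'⟩)⟩

lemma card_quot_lt {V : Subgroup G} (hd : p ∣ Nat.card G) (hall : ∀ w : G, PEl p w → w ∈ V) :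
    Nat.card (G ⧸ V) < Nat.card G := by
  obtain ⟨g, hg⟩ := exists_prime_orderOf_dvd_card' p hd
  have hgV : g ∈ V := hall g ⟨1, by rw [pow_one, ← hg, pow_orderOf_eq_one]⟩
  have hg1 : g ≠ 1 := by
    rintro rfl; rw [orderOf_one] at hg; exact hp.out.one_lt.ne hg
  have : 1 < Nat.card V := by
    have : Nontrivial V := ⟨⟨⟨g, hgV⟩, 1, fun h => hg1 (congrArg Subtype.val h)⟩⟩
    exact Finite.one_lt_card
  rw [card_eq_card_quotient_mul_card_subgroup V]
  have h0 : 0 < Nat.card (G ⧸ V) := Nat.card_pos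
  nlinarith

lemma not_ni_of_card (h : Nat.card G = 1) (x : G) : ¬ NI x := by
  rintro ⟨u, hu⟩
  have : Subsingleton G := Finite.card_le_one_iff_subsingleton.1 h.le
  exact hu ss_trivial

lemma gen_lift {V : Subgroup G} [V.Normal] {c0 : G} (h0 : NI (c0 : G ⧸ V))
    (h : closure {c : G ⧸ V | NI c} = ⊤) : closure {c : G | NI (c : G ⧸ V)} = ⊤ := by
  have hV : V ≤ closure {c : G | NI (c : G ⧸ V)} := by
    intro v hv
    have h1 : c0 * v ∈ closure {c : G | NI (c : G ⧸ V)} := by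
      apply Subgroup.subset_closure
      change NI ((c0 * v : G) : G ⧸ V)
      rwa [show ((c0 * v : G) : G ⧸ V) = c0 from (QuotientGroup.eq.2 (by simpa using hv)).symm]
    have h2 : c0 ∈ closure {c : G | NI (c : G ⧸ V)} := subset_closure h0
    simpa using mul_mem (inv_mem h2) h1
  have hm : (⊤ : Subgroup (G ⧸ V)) ≤ (closure {c : G | NI (c : G ⧸ V)}).map (QuotientGroup.mk' V) := by
    rw [← h, closure_le]
    intro c hc
    obtain ⟨c, rfl⟩ := QuotientGroup.mk_surjective c
    exact ⟨c, subset_closure hc, rfl⟩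
  rw [eq_top_iff]
  intro g _
  obtain ⟨l, hl, e⟩ := hm (mem_top (g : G ⧸ V))
  have := mul_mem hl (hV (QuotientGroup.eq.1 e))
  simpa using this

lemma Dom.ni {V : Subgroup G} {x f : G} (h : Dom V x f) : NI x := by
  obtain ⟨f', -, h1, -⟩ := h x x (by simp) (by simp)
  exact ⟨f', h1⟩

lemma Dom.sat {V : Subgroup G} {x f x1 : G} (h : Dom V x f) {A : Set G} (hA : Closed A)
    (h1 : x⁻¹ * x1 ∈ V) : x ∈ A ↔ x1 ∈ A := by
  obtain ⟨f', -, e1, e2⟩ := h x x1 (by simp) h1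
  exact (hA _ _ e1).trans (hA _ _ e2).symm

lemma Dom.adj {V : Subgroup G} {x f : G} (h : Dom V x f) (h' : Dom V f x) {A : Set G} (hA : Closed A) :
    x ∈ A ↔ f ∈ A := by
  obtain ⟨f', hf, e1, -⟩ := h x x (by simp) (by simp)
  exact (hA _ _ e1).trans (h'.sat hA hf).symm

theorem lemmaZ_aux : ∀ n : ℕ, ∀ (Y : Type u) [Group Y] [Finite Y], Nat.card Y = n →
    (∃ c : Y, NI c) → closure {c : Y | NI c} = ⊤ := by
  intro n
  induction n using Nat.strong_induction_on with
  | _ n ih =>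
  intro Y _ _ hn hc
  obtain ⟨c, hc⟩ := hc
  by_cases h1 : Nat.card Y = 1
  · exact absurd hc (not_ni_of_card h1 c)
  obtain ⟨r, hr, hrd, hle⟩ := exists_max_prime h1
  have : Fact r.Prime := ⟨hr⟩
  obtain ⟨W, hW⟩ : ∃ W, W = Op r Y := ⟨_, rfl⟩
  have hWn : W.Normal := by rw [hW]; exact Op_normal
  have hWp : IsPGroup r W := by rw [hW]; exact Op_pgroup
  by_contra hL
  set L := closure {c : Y | NI c} with hLdef
  have hNL : ∀ c, NI c → c ∈ L := fun c hc => subset_closure hc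
  obtain ⟨d, hd⟩ : ∃ d, d ∉ L := by
    by_contra hcon; push Not at hcon
    exact hL (eq_top_iff.2 fun x _ => hcon x)
  by_cases hall : ∀ w : Y, PEl r w → w ∈ W
  · by_cases hq : ∃ c : Y ⧸ W, NI c
    · have hz := ih _ (by rw [← hn]; exact card_quot_lt hrd hall) (Y ⧸ W) rfl hq
      obtain ⟨c0, hc0⟩ := hq
      obtain ⟨c0, rfl⟩ := QuotientGroup.mk_surjective c0
      have hz' := gen_lift hc0 hz
      apply hL
      rw [eq_top_iff, ← hz']
      exact closure_mono fun c hc => ni_lift hc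
    have hKn := KK_normal hWn
    have key : ∀ d, d ∉ L → ∀ g, Tame r W d g := by
      intro d hd g
      apply tame_of_not_bad hWn hWp hall
      intro hbad
      rcases LB hWn hWp hle hbad with h | h | h | h
      · exact hd (hNL _ h.2.1.ni)
      · exact hd (hNL _ h.2.1.ni)
      · exact hd (hNL _ h.2.1.ni)
      · have := mul_mem (hNL _ h.2.2.1.ni) (inv_mem (hNL _ h.2.1.ni))
        rw [mul_inv_cancel_right] at this
        exact hd this
    obtain ⟨c', hcc⟩ := hc
    have hdc : d * c ∉ L := by
      intro h
      have := mul_mem h (inv_mem (hNL c ⟨c', hcc⟩))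
      rw [mul_inv_cancel_right] at this
      exact hd this
    have t1 := key d hd c'
    have t2 := key d hd c
    have t3 := key _ hdc c'
    have hcomm : ⁅c, c'⁆ ∈ KK W := by
      have e1 := t1.1
      have e3 := t3.1
      rw [comm_mem_iff] at e1 e3 ⊢
      rw [QuotientGroup.mk_mul, mul_assoc, ← mul_assoc (c' : Y ⧸ KK W), ← e1, mul_assoc] at e3
      exact mul_left_cancel e3
    rcases LB hWn hWp hle (hcc.bad (V := W)) with h | h | h | h
    · exact hq ⟨_, _, h.1⟩
    · exact h.1 ⟨hcomm, t2.2.2, t1.2.2⟩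
    · exact h.1 t2.2.2
    · exact h.1 t1.2.2
  · push Not at hall
    obtain ⟨m, e, n', -, hsp⟩ := exists_split r Y
    have hde : d ^ e ∈ W := by
      by_contra h
      obtain ⟨u, hu⟩ := ni_pel hW hle (hsp d).2.2.1 h
      exact hd (hNL _ ⟨u, edge_pow hu⟩)
    obtain ⟨w, pw, hw, hcm⟩ := lemmaH hW hle d hall fun w _ _ h => hd (hNL _ ⟨w, h⟩)
    have hs := split_mul (hsp d).1 (hsp w).1 ((hsp w).2.2.2 pw) hde hw hcm
    obtain ⟨u, hu⟩ := ni_pel hW hle (hsp (d * w)).2.2.1 hs.1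
    have := mul_mem (hNL _ ⟨u, edge_pow hu⟩) (inv_mem (hNL w (ni_pel hW hle pw hw)))
    rw [mul_inv_cancel_right] at this
    exact hd this

theorem lemmaZ (hc : ∃ c : G, NI c) : closure {c : G | NI c} = ⊤ := lemmaZ_aux _ G rfl hc

lemma pick {V : Subgroup G} (hV : V.Normal) (hVp : IsPGroup p V)
    (hle : ∀ q, q.Prime → q ∣ Nat.card G → q ≤ p) {A : Set G} (hA : Closed A) {x : G} (hx : NI x)
    (hxA : x ∈ A) : ∃ d ∈ A, ∃ f ∈ A, Dom V d f ∧ Dom V f d := by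
  obtain ⟨x', hxx⟩ := hx
  have hx' := (hA _ _ hxx).1 hxA
  rcases LB hV hVp hle (hxx.bad (V := V)) with h | h | h | h
  · exact ⟨x, hxA, x', hx', h.2⟩
  · exact ⟨x, hxA, x', hx', h.2⟩
  · exact ⟨x, hxA, x' * x, (h.2.2.2.adj h.2.2.1 hA).1 hxA, h.2.2.2, h.2.2.1⟩
  · exact ⟨x', hx', x * x', (h.2.2.2.adj h.2.2.1 hA).1 hx', h.2.2.2, h.2.2.1⟩

lemma bad_edge {V : Subgroup G} (hV : V.Normal) (hVp : IsPGroup p V)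
    (hle : ∀ q, q.Prime → q ∣ Nat.card G → q ≤ p) {x f : G} (h : Bad V x f) :
    ∃ x1 f1, x⁻¹ * x1 ∈ V ∧ f⁻¹ * f1 ∈ V ∧ Edge x1 f1 := by
  have : Dom V x f ∨ Dom V f x := by
    rcases LB hV hVp hle h with h | h | h | h
    · exact .inl h.2.1
    · exact .inl h.2.1
    · exact .inl h.2.1
    · exact .inr h.2.1
  rcases this with h | h
  · obtain ⟨f', h1, h2, -⟩ := h x x (by simp) (by simp)
    exact ⟨x, f', by simp, h1, h2⟩
  · obtain ⟨f', h1, h2, -⟩ := h f f (by simp) (by simp)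
    exact ⟨f', f, h1, by simp, h2.symm⟩

lemma dom_bad {V : Subgroup G} {x f : G} (h : Dom V x f) : Bad V x f := by
  obtain ⟨f', h1, h2, -⟩ := h x x (by simp) (by simp)
  intro hs
  apply h2
  refine ss_mono ?_ hs
  rw [closure_le]
  rintro z (rfl | rfl)
  · exact mem_sup_left (subset_closure (by simp))
  · have := mul_mem (mem_sup_left (T := V) (subset_closure (by simp : f ∈ ({x, f} : Set G))))
      (mem_sup_right (S := closure {x, f}) h1)
    simpa using this

lemma caseA {V : Subgroup G} [V.Normal] (hV : V = Op p G)
    (hle : ∀ q, q.Prime → q ∣ Nat.card G → q ≤ p) {A : Set G} (hA : Closed A)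
    (hex : ∃ w, PEl p w ∧ w ∉ V) (hw : ∀ w, PEl p w → w ∉ V → w ∉ A) {x : G} (hx : NI x)
    (hxA : x ∈ A) : False := by
  have hVp : IsPGroup p V := by rw [hV]; exact Op_pgroup
  obtain ⟨d, hdA, f, hfA, hdf, hfd⟩ := pick (p := p) inferInstance hVp hle hA hx hxA
  obtain ⟨m, e, n', -, hsp⟩ := exists_split p G
  have key : ∀ g : G, g ^ e ∉ V → g ∉ A := by
    intro g hg hgA
    obtain ⟨u, hu⟩ := ni_pel hV hle (hsp g).2.2.1 hg
    exact hw _ (hsp g).2.2.1 hg ((hA _ _ hu).2 ((hA _ _ (edge_pow hu)).1 hgA))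
  have hde : d ^ e ∈ V := by
    by_contra h; exact key d h hdA
  obtain ⟨w, pw, hwV, hcm⟩ := lemmaH hV hle d hex fun w pw hwV h => hw w pw hwV ((hA _ _ h).1 hdA)
  have hs := split_mul (hsp d).1 (hsp w).1 ((hsp w).2.2.2 pw) hde hwV hcm
  obtain ⟨f', -, e1, e2⟩ := hdf d _ (by simp) hs.2
  exact key _ hs.1 ((hA _ _ (edge_pow e2)).2 ((hA _ _ e1).1 hdA))

lemma tame_dom {V : Subgroup G} (hV : V.Normal) (hVp : IsPGroup p V)
    (hle : ∀ q, q.Prime → q ∣ Nat.card G → q ≤ p) (hall : ∀ w : G, PEl p w → w ∈ V) {a b : G}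
    (h : ⁅a, b⁆ ∉ KK V) (ha : a ^ (p - 1) ∈ KK V) (hb : b ^ (p - 1) ∈ KK V) : Dom V a b ∧ Dom V b a := by
  have hbad : Bad V a b := by
    by_contra hc; exact h (tame_of_not_bad hV hVp hall hc).1
  rcases LB hV hVp hle hbad with h | h | h | h
  · exact h.2
  · exact h.2
  · exact absurd ha h.1
  · exact absurd hb h.1

lemma mul_pow_mem {N : Subgroup G} [N.Normal] {a b : G} {k : ℕ} (hc : ⁅a, b⁆ ∈ N) (ha : a ^ k ∈ N)
    (hb : b ^ k ∈ N) : (a * b) ^ k ∈ N := by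
  rw [comm_mem_iff] at hc
  rw [← QuotientGroup.eq_one_iff, QuotientGroup.mk_pow] at ha hb ⊢
  rw [QuotientGroup.mk_mul, Commute.mul_pow hc, ha, hb, one_mul]

lemma comm_swap {N : Subgroup G} {a b : G} : ⁅a, b⁆ ∈ N ↔ ⁅b, a⁆ ∈ N := by
  rw [← inv_mem_iff, commutatorElement_inv]

/-- if `b` commutes with `c` mod `N`, and `a*b` does, then so does `a` -/
lemma comm_left {N : Subgroup G} [N.Normal] {a b c : G} (h1 : ⁅b, c⁆ ∈ N) (h2 : ⁅a * b, c⁆ ∈ N) :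
    ⁅a, c⁆ ∈ N := by
  rw [comm_mem_iff] at h1 h2 ⊢
  have h1' : Commute (b : G ⧸ N) c := h1
  have h2' : Commute ((a * b : G) : G ⧸ N) c := h2
  have := h2'.mul_left h1'.inv_left
  rwa [QuotientGroup.mk_mul, mul_inv_cancel_right] at this

lemma comm_right {N : Subgroup G} [N.Normal] {a b c : G} (h1 : ⁅a, c⁆ ∈ N) (h2 : ⁅a * b, c⁆ ∈ N) :
    ⁅b, c⁆ ∈ N := by
  rw [comm_mem_iff] at h1 h2 ⊢
  have h1' : Commute (a : G ⧸ N) c := h1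
  have h2' : Commute ((a * b : G) : G ⧸ N) c := h2
  have := h1'.inv_left.mul_left h2'
  rwa [QuotientGroup.mk_mul, inv_mul_cancel_left] at this

lemma caseB {V : Subgroup G} [hV : V.Normal] (hVp : IsPGroup p V)
    (hle : ∀ q, q.Prime → q ∣ Nat.card G → q ≤ p) (hall : ∀ w : G, PEl p w → w ∈ V)
    {A : Set G} (hA : Closed A) {c0 : G} (h0 : NI (c0 : G ⧸ V))
    (hmod : ∀ c : G, NI (c : G ⧸ V) → c ∉ A) {d f : G} (hf : f ∈ A)
    (hdf : ⁅d, f⁆ ∉ KK V) (hdp : d ^ (p - 1) ∈ KK V) (hfp : f ^ (p - 1) ∈ KK V) : False := by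
  have hKn := KK_normal hV
  have step : ∀ c : G, NI (c : G ⧸ V) → ∀ a : G, (⁅a, f⁆ ∉ KK V ∧ a ^ (p - 1) ∈ KK V) →
      (⁅a * c, f⁆ ∉ KK V ∧ (a * c) ^ (p - 1) ∈ KK V) := by
    rintro c hc a ⟨h1, h2⟩
    obtain ⟨D1, D2⟩ := tame_dom hV hVp hle hall h1 h2 hfp
    have haA : a ∈ A := (D1.adj D2 hA).2 hf
    have gen : ∀ a f : G, Dom V a f → a ∈ A → Tame p V a c := by
      intro a f D1 haA
      apply tame_of_not_bad hV hVp hall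
      intro hb
      obtain ⟨a1, c1, ha1, hc1, e⟩ := bad_edge hV hVp hle hb
      have : c1 ∉ A := by
        apply hmod
        rwa [← show (c : G ⧸ V) = c1 from QuotientGroup.eq.2 hc1]
      exact this ((hA _ _ e).1 ((D1.sat hA ha1).1 haA))
    have t1 := gen a f D1 haA
    have t2 := gen f a D2 hf
    exact ⟨fun h => h1 (comm_left (comm_swap.1 t2.1) h), mul_pow_mem t1.1 h2 t1.2.2⟩
  have hgen := gen_lift h0 (lemmaZ ⟨_, h0⟩)
  let S : Submonoid G :=
    { carrier := {c | ∀ a : G, (⁅a, f⁆ ∉ KK V ∧ a ^ (p - 1) ∈ KK V) →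
        (⁅a * c, f⁆ ∉ KK V ∧ (a * c) ^ (p - 1) ∈ KK V)}
      one_mem' := by intro a ha; rwa [mul_one]
      mul_mem' := by intro x y hx hy a ha; rw [← mul_assoc]; exact hy _ (hx _ ha) }
  have hS : ∀ g : G, g ∈ S := by
    intro g
    have hg : g ∈ closure {c : G | NI (c : G ⧸ V)} := by rw [hgen]; trivial
    induction hg using closure_induction with
    | mem x hx => exact step x hx
    | one => exact one_mem S
    | mul x y _ _ hx hy => exact mul_mem hx hy
    | inv x _ hx =>
      have : x⁻¹ ∈ Submonoid.powers x := mem_powers_iff_mem_zpowers.2 (inv_mem (mem_zpowers x))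
      exact (Submonoid.powers_le.2 hx) this
  have := (hS d⁻¹ d ⟨hdf, hdp⟩).1
  rw [mul_inv_cancel, commutatorElement_one_left] at this
  exact this (one_mem _)

theorem main_aux : ∀ n : ℕ, ∀ (G : Type u) [Group G] [Finite G], Nat.card G = n →
    ∀ A : Set G, Closed A → ∀ x y : G, NI x → NI y → x ∈ A → y ∉ A → False := by
  intro n
  induction n using Nat.strong_induction_on with
  | _ n ih =>
  intro G _ _ hn A hA x y hx hy hxA hyA
  by_cases h1 : Nat.card G = 1
  · exact not_ni_of_card h1 x hx
  obtain ⟨p, hp, hpd, hle⟩ := exists_max_prime h1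
  have : Fact p.Prime := ⟨hp⟩
  obtain ⟨V, hV⟩ : ∃ V, V = Op p G := ⟨_, rfl⟩
  have hVn : V.Normal := by rw [hV]; exact Op_normal
  have hVp : IsPGroup p V := by rw [hV]; exact Op_pgroup
  by_cases hall : ∀ w : G, PEl p w → w ∈ V
  swap
  · push Not at hall
    obtain ⟨w, pw, hw⟩ := hall
    by_cases hwA : w ∈ A
    · exact caseA hV hle hA.compl ⟨w, pw, hw⟩ (fun w' pw' hw' h =>
        h ((color_pel hV hle hA pw hw pw' hw').1 hwA)) hy hyA
    · exact caseA hV hle hA ⟨w, pw, hw⟩ (fun w' pw' hw' h =>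
        hwA ((color_pel hV hle hA pw hw pw' hw').2 h)) hx hxA
  have hKn := KK_normal hVn
  have hIH : ∀ a b : G, NI (a : G ⧸ V) → NI (b : G ⧸ V) → a ∈ A → b ∈ A := by
    intro a b ha hb haA
    by_contra hbA
    refine ih _ (by rw [← hn]; exact card_quot_lt hpd hall) (G ⧸ V) rfl
      {c | ∃ a ∈ A, (a : G ⧸ V) = c} ?_ a b ha hb ⟨a, haA, rfl⟩ ?_
    · have : ∀ x y : G ⧸ V, Edge x y → x ∈ {c | ∃ a ∈ A, (a : G ⧸ V) = c} →
          y ∈ {c | ∃ a ∈ A, (a : G ⧸ V) = c} := by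
        rintro x y e ⟨a, ha, rfl⟩
        obtain ⟨y, rfl⟩ := QuotientGroup.mk_surjective y
        exact ⟨y, (hA _ _ (edge_lift e)).1 ha, rfl⟩
      exact fun x y e => ⟨this x y e, this y x e.symm⟩
    · rintro ⟨b', hb', e⟩
      obtain ⟨u, hu⟩ := hb
      obtain ⟨u, rfl⟩ := QuotientGroup.mk_surjective u
      have := (hA _ _ (edge_lift hu))
      have h2 := (hA _ _ (edge_lift (e ▸ hu)))
      exact hbA (this.2 (h2.1 hb'))
  obtain ⟨d, hd, f, hf, Ddf, Dfd⟩ := pick (p := p) hVn hVp hle hA hx hxA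
  obtain ⟨e, he, h, hh, Deh, Dhe⟩ := pick (p := p) hVn hVp hle hA.compl hy hyA
  have cross : ∀ a a' b b' : G, Dom V a a' → Dom V b b' → a ∈ A → b ∉ A → Tame p V a b := by
    intro a a' b b' Da Db ha hb
    apply tame_of_not_bad hVn hVp hall
    intro hbad
    obtain ⟨a1, b1, ha1, hb1, e⟩ := bad_edge hVn hVp hle hbad
    exact hb ((Db.sat hA hb1).2 ((hA _ _ e).1 ((Da.sat hA ha1).1 ha)))
  have tde := cross d f e h Ddf Deh hd he
  have tdh := cross d f h e Ddf Dhe hd hh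
  have tfe := cross f d e h Dfd Deh hf he
  have tfh := cross f d h e Dfd Dhe hf hh
  have alt : ∀ a b : G, Dom V a b → a ^ (p - 1) ∈ KK V → b ^ (p - 1) ∈ KK V →
      Edge (a : G ⧸ V) (b : G ⧸ V) ∨ ⁅a, b⁆ ∉ KK V := by
    intro a b D ha hb
    rcases LB hVn hVp hle (dom_bad D) with h | h | h | h
    · exact .inl h.1
    · exact .inr fun hc => h.1 ⟨hc, ha, hb⟩
    · exact absurd ha h.1
    · exact absurd hb h.1
  rcases alt d f Ddf tde.2.1 tfe.2.1 with a1 | a1 <;> rcases alt e h Deh tde.2.2 tdh.2.2 with a2 | a2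
  · exact he (hIH d e ⟨_, a1⟩ ⟨_, a2⟩ hd)
  · exact caseB hVp hle hall hA.compl ⟨_, a1⟩ (fun c hc hc' => hc' (hIH d c ⟨_, a1⟩ hc hd)) hh a2
      tde.2.2 tdh.2.2
  · exact caseB hVp hle hall hA ⟨_, a2⟩ (fun c hc hc' => he (hIH c e hc ⟨_, a2⟩ hc')) hf a1
      tde.2.1 tfe.2.1
  · have hpow := mul_pow_mem tde.1 tde.2.1 tde.2.2
    obtain ⟨D1, D2⟩ := tame_dom (a := d * e) (b := f) hVn hVp hle hall
      (fun hc => a1 (comm_left (comm_swap.1 tfe.1) hc)) hpow tfe.2.1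
    obtain ⟨D3, D4⟩ := tame_dom (a := d * e) (b := h) hVn hVp hle hall
      (fun hc => a2 (comm_right tdh.1 hc)) hpow tdh.2.2
    exact hh ((D3.adj D4 hA).1 ((D1.adj D2 hA).2 hf))

end P6
end NSG

theorem non_supersoluble_graph_connected (G : Type u) [Group G] [Finite G]
    (x y : G)
    (hx : ∃ u : G, ¬ IsSupersoluble ↥(Subgroup.closure {x, u}))
    (hy : ∃ v : G, ¬ IsSupersoluble ↥(Subgroup.closure {y, v})) :
    ∃ (n : ℕ) (z : Fin (n + 1) → G), z 0 = x ∧ z (Fin.last n) = y ∧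
      ∀ i : Fin n, ¬ IsSupersoluble ↥(Subgroup.closure {z i.castSucc, z i.succ}) := by
  have hxy : Relation.ReflTransGen NSG.Edge x y := by
    by_contra hc
    refine NSG.main_aux _ G rfl {z | Relation.ReflTransGen NSG.Edge x z} ?_ x y hx hy .refl hc
    exact fun a b e => ⟨fun h => h.tail e, fun h => h.tail e.symm⟩
  obtain ⟨k, H, h0, hk, hs⟩ := NSG.rtg_seq hxy
  exact ⟨k, fun i => H i, h0, hk, fun i => hs i i.2⟩
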